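/- Let H be a nearest-neighbor one-dimensional SFT presented by a finite directed graph G = (A, E) in which every vertex has at least one outgoing and one incoming edge, and suppose that every SCC of G is of state-split cycle type. Then for every one-dimensional SFT V ⊆ A^ℤ with X_{H,V} nonempty, the entropy h(X_{H,V}) is a computable real number. -/

import Mathlib

open Filter

/-- Shift on one-dimensional configurations: `(shift1 p x) k = x (k - p)`. -/
def shift1 {A : Type*} (p : ℤ) (x : ℤ → A) : ℤ → A := fun k => x (k - p)

/-- Shift on two-dimensional configurations: `(shift2 v x) k = x (k - v)`. -/
def shift2 {A : Type*} (v : ℤ × ℤ) (x : ℤ × ℤ → A) : ℤ × ℤ → A := fun k => x (k - v)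

/-- The finite word `w` occurs in the bi-infinite sequence `x`. -/
def occursIn1 {A : Type*} (w : List A) (x : ℤ → A) : Prop :=
  ∃ i : ℤ, ∀ (n : ℕ) (h : n < w.length), x (i + n) = w.get ⟨n, h⟩

/-- The one-dimensional SFT avoiding the finite set `F` of forbidden words. -/
def SFT1 {A : Type*} (F : Finset (List A)) : Set (ℤ → A) :=
  {x | ∀ w ∈ F, ¬ occursIn1 w x}

/-- `H` is a one-dimensional subshift of finite type. -/
def IsSFT1 {A : Type*} (H : Set (ℤ → A)) : Prop :=
  ∃ F : Finset (List A), H = SFT1 F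

/-- A finite two-dimensional pattern: a finite support together with values. -/
structure Pattern2 (A : Type*) where
  support : Finset (ℤ × ℤ)
  val : ℤ × ℤ → A

/-- The pattern `p` occurs in the configuration `x`. -/
def Pattern2.OccursIn {A : Type*} (p : Pattern2 A) (x : ℤ × ℤ → A) : Prop :=
  ∃ v : ℤ × ℤ, ∀ u ∈ p.support, x (u + v) = p.val u

/-- The two-dimensional SFT avoiding the finite set `F` of forbidden patterns. -/
def SFT2 {A : Type*} (F : Finset (Pattern2 A)) : Set (ℤ × ℤ → A) :=
  {x | ∀ p ∈ F, ¬ p.OccursIn x}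

/-- The SFT `X_F` with added horizontal constraints from `H`: every row lies in `H`
and no pattern of `F` occurs. -/
def XHF {A : Type*} (H : Set (ℤ → A)) (F : Finset (Pattern2 A)) : Set (ℤ × ℤ → A) :=
  {x | (∀ j : ℤ, (fun k => x (k, j)) ∈ H) ∧ ∀ p ∈ F, ¬ p.OccursIn x}

/-- The combined subshift: rows in `H`, columns in `V`. -/
def XHV {A : Type*} (H V : Set (ℤ → A)) : Set (ℤ × ℤ → A) :=
  {x | (∀ j : ℤ, (fun k => x (k, j)) ∈ H) ∧ ∀ i : ℤ, (fun l => x (i, l)) ∈ V}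

/-- Number of restrictions of elements of `X` to `[0,m) × [0,n)`. -/
noncomputable def patCount2 {A : Type*} (X : Set (ℤ × ℤ → A)) (m n : ℕ) : ℕ :=
  Set.ncard {p : Fin m → Fin n → A |
    ∃ x ∈ X, ∀ (i : Fin m) (j : Fin n), x ((i : ℤ), (j : ℤ)) = p i j}

/-- Topological entropy of a two-dimensional subshift. -/
noncomputable def entropy2 {A : Type*} (X : Set (ℤ × ℤ → A)) : ℝ :=
  ⨅ n : ℕ, Real.logb 2 (patCount2 X (n + 1) (n + 1)) / ((n : ℝ) + 1) ^ 2

/-- The word `w` belongs to the language of `H`. -/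
def wordIn {A : Type*} (H : Set (ℤ → A)) (w : List A) : Prop :=
  ∃ x ∈ H, occursIn1 w x

/-- Number of length-`n` words in the language of `H`. -/
noncomputable def wordCount {A : Type*} (H : Set (ℤ → A)) (n : ℕ) : ℕ :=
  Set.ncard {w : List A | w.length = n ∧ wordIn H w}

/-- Topological entropy of a one-dimensional subshift. -/
noncomputable def entropy1 {A : Type*} (H : Set (ℤ → A)) : ℝ :=
  ⨅ n : ℕ, Real.logb 2 (wordCount H (n + 1)) / ((n : ℝ) + 1)

/-- `X` is a two-dimensional subshift (closed and shift-invariant). -/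
def IsSubshift2 {A : Type*} [TopologicalSpace A] (X : Set (ℤ × ℤ → A)) : Prop :=
  IsClosed X ∧ ∀ (v : ℤ × ℤ) (x : ℤ × ℤ → A), x ∈ X → shift2 v x ∈ X

/-- `X` is an `(m,n)`-th root of `Y`. -/
def IsRoot {A B : Type*} [TopologicalSpace A] [TopologicalSpace B]
    (X : Set (ℤ × ℤ → A)) (Y : Set (ℤ × ℤ → B)) (m n : ℕ) : Prop :=
  ∃ Z : Set (ℤ × ℤ → A), Z ⊆ X ∧ IsClopen {x : X | (x : ℤ × ℤ → A) ∈ Z} ∧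
    shift2 ((m : ℤ), 0) '' Z = Z ∧ shift2 (0, (n : ℤ)) '' Z = Z ∧
    (∃ φ : Z ≃ₜ Y,
      ∀ (x : Z) (k₁ k₂ : ℤ)
        (hx : shift2 (k₁ * (m : ℤ), k₂ * (n : ℤ)) (x : ℤ × ℤ → A) ∈ Z),
        (φ ⟨shift2 (k₁ * (m : ℤ), k₂ * (n : ℤ)) (x : ℤ × ℤ → A), hx⟩ : ℤ × ℤ → B) =
          shift2 (k₁, k₂) (φ x : ℤ × ℤ → B)) ∧
    (∀ i j : ℕ, i < m → j < n → shift2 ((i : ℤ), (j : ℤ)) '' Z ⊆ X) ∧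
    ∀ x ∈ X, ∃! q : Fin m × Fin n, x ∈ shift2 ((q.1 : ℤ), (q.2 : ℤ)) '' Z

/-- The vertex shift (nearest-neighbor SFT) of a directed graph on `A`. -/
def vertexShift {A : Type*} (E : A → A → Prop) : Set (ℤ → A) :=
  {x | ∀ i : ℤ, E (x i) (x (i + 1))}

/-- Strongly connected component: a maximal nonempty set whose vertices are pairwise
joined by nonempty directed paths. -/
def IsSCC {A : Type*} (E : A → A → Prop) (S : Set A) : Prop :=
  S.Nonempty ∧ (∀ a ∈ S, ∀ b ∈ S, Relation.TransGen E a b) ∧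
    ∀ T : Set A, S ⊆ T → (∀ a ∈ T, ∀ b ∈ T, Relation.TransGen E a b) → T = S

def ReflexiveType {A : Type*} (E : A → A → Prop) (S : Set A) : Prop :=
  ∀ v ∈ S, E v v

def SymmetricType {A : Type*} (E : A → A → Prop) (S : Set A) : Prop :=
  ∀ v ∈ S, ∀ w ∈ S, v ≠ w → E v w → E w v

def StateSplitType {A : Type*} (E : A → A → Prop) (S : Set A) : Prop :=
  ∃ p : ℕ, 0 < p ∧ ∃ f : A → ZMod p,
    (∀ i : ZMod p, ∃ v ∈ S, f v = i) ∧
    ∀ v ∈ S, ∀ w ∈ S, (E v w ↔ f w = f v + 1)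

/-- Condition D: all SCCs share one of the three types. -/
def ConditionD {A : Type*} (E : A → A → Prop) : Prop :=
  (∀ S : Set A, IsSCC E S → ReflexiveType E S) ∨
  (∀ S : Set A, IsSCC E S → SymmetricType E S) ∨
  (∀ S : Set A, IsSCC E S → StateSplitType E S)

/-- A real is Π₁-computable (right-recursively enumerable). -/
def Pi1Computable (x : ℝ) : Prop :=
  ∃ f : ℕ → ℚ, Computable f ∧ Antitone f ∧
    Tendsto (fun n => (f n : ℝ)) atTop (nhds x)

/-- A computable real number. -/
def IsComputableReal (x : ℝ) : Prop :=
  ∃ f : ℕ → ℚ, Computable f ∧ ∀ n : ℕ, |(f n : ℝ) - x| ≤ (2 : ℝ) ^ (-(n : ℤ))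

/-- `w` is a finite concatenation of copies of `w₁` and `w₂`. -/
def IsConcat {A : Type*} (w₁ w₂ w : List A) : Prop :=
  ∃ L : List (List A), (∀ v ∈ L, v = w₁ ∨ v = w₂) ∧ w = L.flatten

/-- Transitivity of a one-dimensional subshift. -/
def Transitive1 {A : Type*} (H : Set (ℤ → A)) : Prop :=
  ∀ u w : List A, wordIn H u → wordIn H w → ∃ v : List A, wordIn H (u ++ v ++ w)

/-- The subshift of elements of `H` avoiding the word `u`. -/
def avoidWord {A : Type*} (H : Set (ℤ → A)) (u : List A) : Set (ℤ → A) :=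
  {x ∈ H | ¬ occursIn1 u x}

/-- The code of a rational in the product encoding of numerator and denominator. -/
def ratCode (q : ℚ) : ℕ := @Encodable.encode ℚ Rat.instEncodable q

theorem ratCode_eq (q : ℚ) : ratCode q = Nat.pair (Encodable.encode q.num) q.den := rfl

theorem natAbs_eq_encode_half (z : ℤ) : z.natAbs = (Encodable.encode z + 1) / 2 := by
  rcases z with n | n
  · change n = (2 * n + 1) / 2
    omega
  · change n + 1 = (2 * n + 1 + 1) / 2
    omega

theorem mem_range_ratCode (m : ℕ) : m ∈ Set.range ratCode ↔
    0 < m.unpair.2 ∧ ∀ d < m.unpair.2 + 1, 1 < d →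
      ¬ (((m.unpair.1 + 1) / 2) % d = 0 ∧ m.unpair.2 % d = 0) := by
  have key : ∀ a b : ℕ, 0 < b → ((∀ d < b + 1, 1 < d → ¬ (a % d = 0 ∧ b % d = 0)) ↔
      Nat.Coprime a b) := by
    intro a b hb
    constructor
    · intro h
      by_contra hc
      have h1 : Nat.gcd a b ≠ 0 := by
        intro h0
        have := Nat.eq_zero_of_gcd_eq_zero_right h0
        omega
      have h2 : Nat.gcd a b ≤ b := Nat.gcd_le_right _ hb
      have h3 : Nat.gcd a b ≠ 1 := hc
      exact h (Nat.gcd a b) (by omega) (by omega)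
        ⟨Nat.mod_eq_zero_of_dvd (Nat.gcd_dvd_left a b),
          Nat.mod_eq_zero_of_dvd (Nat.gcd_dvd_right a b)⟩
    · rintro h d - hd ⟨h1, h2⟩
      have := Nat.dvd_gcd (Nat.dvd_of_mod_eq_zero h1) (Nat.dvd_of_mod_eq_zero h2)
      rw [h] at this
      have := Nat.dvd_one.1 this
      omega
  constructor
  · rintro ⟨q, rfl⟩
    rw [ratCode_eq, Nat.unpair_pair]
    refine ⟨q.pos, (key _ _ q.pos).2 ?_⟩
    rw [← natAbs_eq_encode_half]
    exact q.reduced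
  · rintro ⟨h0, h⟩
    rw [key _ _ h0] at h
    have he : Encodable.encode (Denumerable.ofNat ℤ m.unpair.1) = m.unpair.1 :=
      Denumerable.encode_ofNat _
    refine ⟨⟨Denumerable.ofNat ℤ m.unpair.1, m.unpair.2, by omega, ?_⟩, ?_⟩
    · rw [natAbs_eq_encode_half, he]
      exact h
    · rw [ratCode_eq]
      simp only [he, Nat.pair_unpair]

theorem primrecPred_mem_range_ratCode : PrimrecPred (fun m => m ∈ Set.range ratCode) := by
  have hdvd : PrimrecRel (fun d m : ℕ => 1 < d →
      ¬ (((m.unpair.1 + 1) / 2) % d = 0 ∧ m.unpair.2 % d = 0)) := by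
    have h1 : PrimrecPred (fun x : ℕ × ℕ => 1 < x.1) :=
      Primrec.nat_lt.comp (Primrec.const 1) Primrec.fst
    have hu : Primrec (fun x : ℕ × ℕ => x.2.unpair) := Primrec.unpair.comp Primrec.snd
    have h2 : PrimrecPred (fun x : ℕ × ℕ => ((x.2.unpair.1 + 1) / 2) % x.1 = 0) :=
      Primrec.eq.comp (Primrec.nat_mod.comp (Primrec.nat_div.comp
        (Primrec.succ.comp (Primrec.fst.comp hu)) (Primrec.const 2)) Primrec.fst)
        (Primrec.const 0)
    have h3 : PrimrecPred (fun x : ℕ × ℕ => x.2.unpair.2 % x.1 = 0) :=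
      Primrec.eq.comp (Primrec.nat_mod.comp (Primrec.snd.comp hu) Primrec.fst)
        (Primrec.const 0)
    refine (h1.not.or (h2.and h3).not).of_eq ?_
    intro x
    tauto
  have h4 := (PrimrecRel.forall_lt hdvd).comp
    (Primrec.succ.comp (Primrec.snd.comp Primrec.unpair)) Primrec.id
  have h5 : PrimrecPred (fun m : ℕ => 0 < m.unpair.2) :=
    Primrec.nat_lt.comp (Primrec.const 0) (Primrec.snd.comp Primrec.unpair)
  exact (h5.and h4).of_eq fun m => (mem_range_ratCode m).symm

/-- A rational-valued function is computable once its product codes are. -/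
theorem computable_rat_of_ratCode {f : ℕ → ℚ} (h : Computable fun n => ratCode (f n)) :
    Computable f := by
  classical
  have hcount : Primrec (fun n : ℕ =>
      ((List.range n).filter (fun m => m ∈ Set.range ratCode)).length) :=
    Primrec.list_length.comp
      ((Primrec.listFilter primrecPred_mem_range_ratCode).comp Primrec.list_range)
  refine Computable.encode_iff.1 ((hcount.to_comp.comp h).of_eq fun n => ?_)
  rw [← List.countP_eq_length_filter]
  change _ = List.countP (fun m => @Decidable.decide (m ∈ Set.range ratCode)
    (@Encodable.decidableRangeEncode ℚ Rat.instEncodable m)) (List.range (ratCode (f n)))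
  congr 1
  funext m
  congr

theorem primrec_two_pow : Primrec (fun n : ℕ => 2 ^ n) := by
  refine (Primrec.nat_rec₁ (f := fun _ x => 2 * x) 1
    (Primrec.nat_double.comp Primrec.snd).to₂).of_eq fun n => ?_
  induction n with
  | zero => rfl
  | succ n ih => simp only [ih, pow_succ]; ring

/-- Dyadic rationals with odd numerator are already in lowest terms. -/
theorem computable_odd_dyadic {k : ℕ → ℕ} (hk : Computable k) :
    Computable (fun n => ((2 * k n + 1 : ℕ) : ℚ) / ((2 ^ (n + 1) : ℕ) : ℚ)) := by
  apply computable_rat_of_ratCode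
  have hcop : ∀ n, Nat.Coprime (2 * k n + 1) (2 ^ (n + 1)) := fun n =>
    Nat.Coprime.pow_right _ (by simp)
  have h1 : Computable (fun n => Nat.pair (2 * (2 * k n + 1)) (2 ^ (n + 1))) :=
    Primrec₂.natPair.to_comp.comp
      (Primrec.nat_double.to_comp.comp (Primrec.nat_double_succ.to_comp.comp hk))
      (primrec_two_pow.comp Primrec.succ).to_comp
  refine h1.of_eq fun n => ?_
  have hd : ((2 ^ (n + 1) : ℕ) : ℤ) ≠ 0 := by positivity
  have hn : (((2 * k n + 1 : ℕ) : ℚ) / ((2 ^ (n + 1) : ℕ) : ℚ)).num = ((2 * k n + 1 : ℕ) : ℤ) := by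
    have := Rat.num_div_eq_of_coprime (a := ((2 * k n + 1 : ℕ) : ℤ))
      (b := ((2 ^ (n + 1) : ℕ) : ℤ)) (by positivity) (by simp)
    simpa using this
  have hn' : (((2 * k n + 1 : ℕ) : ℚ) / ((2 ^ (n + 1) : ℕ) : ℚ)).den = 2 ^ (n + 1) := by
    have := Rat.den_div_eq_of_coprime (a := ((2 * k n + 1 : ℕ) : ℤ))
      (b := ((2 ^ (n + 1) : ℕ) : ℤ)) (by positivity) (by simp)
    zify
    simpa using this
  rw [ratCode_eq, hn, hn']
  rfl

section JointGrowth

variable {J C R : Type*} [Fintype J] [DecidableEq J]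

/-- The product of the matrices labelled by the letters of a word. -/
def wordProd [Semiring R] (M : C → Matrix J J R) (w : List C) : Matrix J J R := (w.map M).prod

theorem wordProd_nil [Semiring R] (M : C → Matrix J J R) : wordProd M [] = 1 := rfl

theorem wordProd_cons [Semiring R] (M : C → Matrix J J R) (c : C) (w : List C) :
    wordProd M (c :: w) = M c * wordProd M w := by
  simp [wordProd]

theorem wordProd_append [Semiring R] (M : C → Matrix J J R) (v w : List C) :
    wordProd M (v ++ w) = wordProd M v * wordProd M w := by
  simp [wordProd]

theorem wordProd_nonneg {M : C → Matrix J J ℝ} (hM : ∀ c p q, 0 ≤ M c p q) (w : List C) (p q : J) :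
    0 ≤ wordProd M w p q := by
  induction w generalizing p with
  | nil =>
    rw [wordProd_nil, Matrix.one_apply]
    split_ifs <;> norm_num
  | cons c w ih =>
    rw [wordProd_cons, Matrix.mul_apply]
    exact Finset.sum_nonneg fun r _ => mul_nonneg (hM _ _ _) (ih _)

theorem wordProd_mul_le {M : C → Matrix J J ℝ} (hM : ∀ c p q, 0 ≤ M c p q) (v w : List C)
    (p q r : J) : wordProd M v p q * wordProd M w q r ≤ wordProd M (v ++ w) p r := by
  rw [wordProd_append, Matrix.mul_apply]
  exact Finset.single_le_sum (f := fun q => wordProd M v p q * wordProd M w q r)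
    (fun q _ => mul_nonneg (wordProd_nonneg hM _ _ _) (wordProd_nonneg hM _ _ _))
    (Finset.mem_univ q)

/-- `q` is reached from `p` with positive weight. -/
def Reaches (M : C → Matrix J J ℝ) (p q : J) : Prop := ∃ w, 0 < wordProd M w p q

theorem Reaches.refl (M : C → Matrix J J ℝ) (p : J) : Reaches M p p :=
  ⟨[], by simp [wordProd_nil]⟩

theorem Reaches.trans {M : C → Matrix J J ℝ} (hM : ∀ c p q, 0 ≤ M c p q) {p q r : J}
    (h₁ : Reaches M p q) (h₂ : Reaches M q r) : Reaches M p r := by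
  obtain ⟨v, hv⟩ := h₁
  obtain ⟨w, hw⟩ := h₂
  exact ⟨v ++ w, (mul_pos hv hw).trans_le (wordProd_mul_le hM v w p q r)⟩

theorem Reaches.single {M : C → Matrix J J ℝ} {p q : J} {c : C} (h : 0 < M c p q) :
    Reaches M p q := ⟨[c], by simpa [wordProd] using h⟩

variable {M : C → Matrix J J ℝ} {lam : ℝ}

theorem exists_wordProd_le_of_mutual (hM : ∀ c p q, 0 ≤ M c p q) (hlam : 1 ≤ lam)
    (hdiag : ∀ w p, wordProd M w p p ≤ lam ^ w.length) :
    ∃ K : ℝ, 0 ≤ K ∧ ∀ p q, Reaches M q p → ∀ w, wordProd M w p q ≤ K * lam ^ w.length := by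
  have h0 : 0 < lam := by linarith
  have hex : ∀ p q, ∃ K : ℝ, 0 ≤ K ∧ (Reaches M q p →
      ∀ w, wordProd M w p q ≤ K * lam ^ w.length) := by
    intro p q
    by_cases hr : Reaches M q p
    · obtain ⟨u, hu⟩ := hr
      refine ⟨lam ^ u.length / wordProd M u q p, by positivity, fun _ w => ?_⟩
      have h1 := (wordProd_mul_le hM w u p q p).trans (hdiag _ _)
      rw [List.length_append, pow_add] at h1
      rw [div_mul_eq_mul_div, le_div_iff₀ hu]
      linarith
    · exact ⟨0, le_rfl, fun h => absurd h hr⟩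
  choose K hK0 hK using hex
  refine ⟨∑ p, ∑ q, K p q, Finset.sum_nonneg fun p _ => Finset.sum_nonneg fun q _ => hK0 p q, ?_⟩
  intro p q hr w
  refine (hK p q hr w).trans (mul_le_mul_of_nonneg_right ?_ (by positivity))
  exact (Finset.single_le_sum (f := fun q => K p q) (fun q _ => hK0 p q) (Finset.mem_univ q)).trans
    (Finset.single_le_sum (f := fun p => ∑ q, K p q)
      (fun p _ => Finset.sum_nonneg fun q _ => hK0 p q) (Finset.mem_univ p))

open Classical in
theorem sum_nonmutual_le [Fintype C] (hM : ∀ c p q, 0 ≤ M c p q) (hlam : 1 ≤ lam) {K₁ K : ℝ}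
    {D : ℕ} (hK₁ : 0 ≤ K₁) (hK : 0 ≤ K) (p q : J)
    (h₁ : ∀ r, Reaches M p r → Reaches M r p → ∀ w, wordProd M w p r ≤ K₁ * lam ^ w.length)
    (h₂ : ∀ r, Reaches M p r → ¬ Reaches M r p →
      ∀ w, wordProd M w r q ≤ K * (w.length + 1) ^ D * lam ^ w.length) (w v : List C) :
    ∑ s with ¬ (Reaches M p s ∧ Reaches M s p), wordProd M w p s * wordProd M v s q ≤
      w.length * ((∑ _r : J, ∑ _s : J, K₁ * (∑ c, ∑ a, ∑ b, M c a b) * K) *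
        ((w.length + v.length : ℕ) + 1) ^ D * lam ^ (w.length + v.length)) := by
  have hlam0 : 0 ≤ lam := by linarith
  set Mx : ℝ := ∑ c, ∑ a, ∑ b, M c a b with hMx
  have hMx0 : 0 ≤ Mx := Finset.sum_nonneg fun c _ => Finset.sum_nonneg fun a _ =>
    Finset.sum_nonneg fun b _ => hM c a b
  have hle : ∀ c a b, M c a b ≤ Mx := fun c a b =>
    (Finset.single_le_sum (f := fun b => M c a b) (fun b _ => hM c a b) (Finset.mem_univ b)).trans
    ((Finset.single_le_sum (f := fun a => ∑ b, M c a b)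
      (fun a _ => Finset.sum_nonneg fun b _ => hM c a b) (Finset.mem_univ a)).trans
    (Finset.single_le_sum (f := fun c => ∑ a, ∑ b, M c a b)
      (fun c _ => Finset.sum_nonneg fun a _ => Finset.sum_nonneg fun b _ => hM c a b)
      (Finset.mem_univ c)))
  have hN := wordProd_nonneg hM
  induction w using List.reverseRecOn generalizing v with
  | nil =>
    refine (Finset.sum_nonpos fun s hs => ?_).trans (by simp)
    rw [Finset.mem_filter] at hs
    have : p ≠ s := by
      rintro rfl
      exact hs.2 ⟨Reaches.refl M p, Reaches.refl M p⟩
    simp [wordProd_nil, this]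
  | append_singleton w c ih =>
    have hc : wordProd M [c] = M c := by simp [wordProd]
    have hsplit : ∀ s, wordProd M (w ++ [c]) p s * wordProd M v s q =
        (∑ r with ¬ (Reaches M p r ∧ Reaches M r p),
          wordProd M w p r * (M c r s * wordProd M v s q)) +
        ∑ r with (Reaches M p r ∧ Reaches M r p),
          wordProd M w p r * (M c r s * wordProd M v s q) := by
      intro s
      rw [add_comm, Finset.sum_filter_add_sum_filter_not, wordProd_append, Matrix.mul_apply, hc,
        Finset.sum_mul]
      exact Finset.sum_congr rfl fun r _ => by ring
    rw [Finset.sum_congr rfl fun s _ => hsplit s, Finset.sum_add_distrib]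
    have hA : ∑ s with ¬ (Reaches M p s ∧ Reaches M s p),
        ∑ r with ¬ (Reaches M p r ∧ Reaches M r p),
          wordProd M w p r * (M c r s * wordProd M v s q) ≤
        ∑ r with ¬ (Reaches M p r ∧ Reaches M r p),
          wordProd M w p r * wordProd M (c :: v) r q := by
      rw [Finset.sum_comm]
      refine Finset.sum_le_sum fun r _ => ?_
      rw [wordProd_cons, Matrix.mul_apply, Finset.mul_sum]
      exact Finset.sum_le_sum_of_subset_of_nonneg (Finset.filter_subset _ _) fun s _ _ =>
        mul_nonneg (hN _ _ _) (mul_nonneg (hM _ _ _) (hN _ _ _))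
    have hB : ∑ s with ¬ (Reaches M p s ∧ Reaches M s p),
        ∑ r with (Reaches M p r ∧ Reaches M r p),
          wordProd M w p r * (M c r s * wordProd M v s q) ≤
        ∑ _r : J, ∑ _s : J, (K₁ * Mx * K) * (((w.length + v.length + 1 : ℕ) + 1 : ℝ) ^ D *
          lam ^ (w.length + v.length + 1)) := by
      rw [Finset.sum_comm]
      have hterm0 : 0 ≤ (K₁ * Mx * K) * (((w.length + v.length + 1 : ℕ) + 1 : ℝ) ^ D *
          lam ^ (w.length + v.length + 1)) := by positivity
      refine (Finset.sum_le_sum (g := fun _ => ∑ _s : J, (K₁ * Mx * K) *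
        (((w.length + v.length + 1 : ℕ) + 1 : ℝ) ^ D * lam ^ (w.length + v.length + 1)))
        fun r hr => (Finset.sum_le_sum (g := fun _ => (K₁ * Mx * K) *
        (((w.length + v.length + 1 : ℕ) + 1 : ℝ) ^ D * lam ^ (w.length + v.length + 1)))
          fun s hs => ?_).trans (Finset.sum_le_sum_of_subset_of_nonneg
          (Finset.filter_subset _ _) fun _ _ _ => hterm0)).trans
        (Finset.sum_le_sum_of_subset_of_nonneg (Finset.filter_subset _ _) fun _ _ _ =>
          Finset.sum_nonneg fun _ _ => hterm0)
      rw [Finset.mem_filter] at hr hs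
      change wordProd M w p r * (M c r s * wordProd M v s q) ≤ _
      rcases (hM c r s).eq_or_lt with h0 | hpos
      · rw [← h0]
        simpa using hterm0
      have hps : Reaches M p s := hr.2.1.trans hM (Reaches.single hpos)
      have hsp : ¬ Reaches M s p := fun h => hs.2 ⟨hps, h⟩
      calc wordProd M w p r * (M c r s * wordProd M v s q)
          ≤ (K₁ * lam ^ w.length) * (Mx * (K * (v.length + 1) ^ D * lam ^ v.length)) := by
            refine mul_le_mul (h₁ r hr.2.1 hr.2.2 w) ?_ (mul_nonneg (hM _ _ _) (hN _ _ _))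
              (by positivity)
            exact mul_le_mul (hle _ _ _) (h₂ s hps hsp v) (hN _ _ _) hMx0
        _ = (K₁ * Mx * K) * ((v.length + 1 : ℝ) ^ D * lam ^ (w.length + v.length)) := by
            rw [pow_add]; ring
        _ ≤ _ := by
            refine mul_le_mul_of_nonneg_left ?_ (by positivity)
            refine mul_le_mul ?_ (pow_le_pow_right₀ hlam (by omega)) (by positivity)
              (by positivity)
            refine pow_le_pow_left₀ (by positivity) ?_ D
            push_cast
            nlinarith [(Nat.cast_nonneg w.length : (0 : ℝ) ≤ _)]
    refine (add_le_add (hA.trans (ih (c :: v))) hB).trans (le_of_eq ?_)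
    have e1 : w.length + (c :: v).length = w.length + v.length + 1 := by simp; omega
    have e2 : (w ++ [c]).length + v.length = w.length + v.length + 1 := by simp; omega
    rw [e1, e2]
    simp only [Finset.sum_const, Finset.card_univ, nsmul_eq_mul, List.length_append,
      List.length_singleton]
    push_cast
    ring

open Classical in
/-- If all diagonal entries of products of nonnegative matrices grow at most like `lam ^ n`, then
all entries grow at most like a polynomial times `lam ^ n`. -/
theorem wordProd_poly_growth [Fintype C] (hM : ∀ c p q, 0 ≤ M c p q) (hlam : 1 ≤ lam)
    (hdiag : ∀ w p, wordProd M w p p ≤ lam ^ w.length) :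
    ∃ K : ℝ, 0 ≤ K ∧ ∃ D : ℕ, ∀ w p q,
      wordProd M w p q ≤ K * (w.length + 1) ^ D * lam ^ w.length := by
  have hlam0 : 0 ≤ lam := by linarith
  obtain ⟨K₁, hK₁, h₁⟩ := exists_wordProd_le_of_mutual hM hlam hdiag
  have key : ∀ k : ℕ, ∃ K : ℝ, 0 ≤ K ∧ ∃ D : ℕ, ∀ p, Set.ncard {q | Reaches M p q} ≤ k →
      ∀ w q, wordProd M w p q ≤ K * (w.length + 1) ^ D * lam ^ w.length := by
    intro k
    induction k with
    | zero =>
      refine ⟨0, le_rfl, 0, fun p hp => ?_⟩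
      have : ({q | Reaches M p q} : Set J) = ∅ := by
        rwa [Nat.le_zero, Set.ncard_eq_zero (Set.toFinite _)] at hp
      exact absurd (Reaches.refl M p) (Set.eq_empty_iff_forall_notMem.1 this p)
    | succ k ih =>
      obtain ⟨K, hK, D, h⟩ := ih
      set B : ℝ := ∑ _r : J, ∑ _s : J, K₁ * (∑ c, ∑ a, ∑ b, M c a b) * K with hB
      have hB0 : 0 ≤ B := Finset.sum_nonneg fun _ _ => Finset.sum_nonneg fun _ _ =>
        mul_nonneg (mul_nonneg hK₁ (Finset.sum_nonneg fun c _ => Finset.sum_nonneg fun a _ =>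
          Finset.sum_nonneg fun b _ => hM c a b)) hK
      refine ⟨K₁ + B, by positivity, D + 1, fun p hp w q => ?_⟩
      have hlen : (1 : ℝ) ≤ (w.length : ℝ) + 1 := by
        linarith [(Nat.cast_nonneg w.length : (0 : ℝ) ≤ _)]
      by_cases hq : Reaches M p q ∧ Reaches M q p
      · refine (h₁ p q hq.2 w).trans (mul_le_mul_of_nonneg_right ?_ (by positivity))
        calc K₁ ≤ K₁ + B := by linarith
          _ ≤ (K₁ + B) * ((w.length : ℝ) + 1) ^ (D + 1) :=
            le_mul_of_one_le_right (by positivity) (one_le_pow₀ hlen)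
      · have hs := sum_nonmutual_le hM hlam hK₁ hK p q (D := D)
          (fun r _ hr w => h₁ p r hr w) (fun r hpr hrp w => h r ?_ w q) w []
        · have hsing : wordProd M w p q ≤ ∑ s with ¬ (Reaches M p s ∧ Reaches M s p),
              wordProd M w p s * wordProd M [] s q := by
            have := Finset.single_le_sum
              (f := fun s => wordProd M w p s * wordProd M [] s q)
              (s := Finset.univ.filter fun s => ¬ (Reaches M p s ∧ Reaches M s p))
              (fun s _ => mul_nonneg (wordProd_nonneg hM _ _ _) (wordProd_nonneg hM _ _ _))
              (a := q) (by simpa using hq)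
            simpa [wordProd_nil] using this
          refine (hsing.trans hs).trans ?_
          simp only [List.length_nil, add_zero]
          rw [← hB]
          calc (w.length : ℝ) * (B * (w.length + 1) ^ D * lam ^ w.length)
              ≤ ((w.length : ℝ) + 1) * ((K₁ + B) * (w.length + 1) ^ D * lam ^ w.length) := by
                gcongr <;> linarith
            _ = _ := by ring
        · have hlt : Set.ncard {s | Reaches M r s} < Set.ncard {s | Reaches M p s} := by
            refine Set.ncard_lt_ncard ?_ (Set.toFinite _)
            refine ⟨fun s hs => hpr.trans hM hs, fun hsub => hrp ?_⟩
            exact hsub (Reaches.refl M p)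
          omega
  obtain ⟨K, hK, D, h⟩ := key (Fintype.card J)
  refine ⟨K, hK, D, fun w p q => h p ?_ w q⟩
  rw [← Nat.card_eq_fintype_card]
  exact Set.ncard_le_card _

theorem natCast_wordProd (M : C → Matrix J J ℕ) (w : List C) (p q : J) :
    ((wordProd M w p q : ℕ) : ℝ) = wordProd (fun c => (M c).map (Nat.cast : ℕ → ℝ)) w p q := by
  induction w generalizing p with
  | nil => simp [wordProd_nil, Matrix.one_apply]
  | cons c w ih => simp [wordProd_cons, Matrix.mul_apply, ih]

end JointGrowth

section GrowthComputable

variable {r d : ℕ}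

/-- The vectors of row sums of all products of `n` of the given matrices. -/
def rowSumList (M : Fin r → Matrix (Fin d) (Fin d) ℕ) : ℕ → List (Fin d → ℕ)
  | 0 => [fun _ => 1]
  | n + 1 => (rowSumList M n).flatMap fun v => (List.finRange r).map fun c i => ∑ j, M c i j * v j

/-- The maximum of `1` and all sums of entries of products of `n` of the given matrices. -/
def maxGrowth (M : Fin r → Matrix (Fin d) (Fin d) ℕ) (n : ℕ) : ℕ :=
  (rowSumList M n).foldr (fun v m => max (∑ i, v i) m) 1

theorem mem_rowSumList (M : Fin r → Matrix (Fin d) (Fin d) ℕ) (n : ℕ) (v : Fin d → ℕ) :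
    v ∈ rowSumList M n ↔ ∃ w : List (Fin r), w.length = n ∧ v = fun p => ∑ q, wordProd M w p q := by
  induction n generalizing v with
  | zero =>
    simp only [rowSumList, List.mem_singleton, List.length_eq_zero_iff, exists_eq_left]
    simp [wordProd_nil, Matrix.one_apply]
  | succ n ih =>
    have hstep : ∀ (c : Fin r) (w : List (Fin r)),
        (fun i => ∑ j, M c i j * ∑ q, wordProd M w j q) =
          fun p => ∑ q, wordProd M (c :: w) p q := by
      intro c w
      funext i
      simp only [wordProd_cons, Matrix.mul_apply, Finset.mul_sum]
      exact Finset.sum_comm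
    simp only [rowSumList, List.mem_flatMap, ih, List.mem_map, List.mem_finRange, true_and]
    constructor
    · rintro ⟨_, ⟨w, hw, rfl⟩, c, rfl⟩
      exact ⟨c :: w, by simp [hw], hstep c w⟩
    · rintro ⟨w, hw, rfl⟩
      obtain ⟨c, w, rfl⟩ := List.exists_cons_of_length_eq_add_one hw
      exact ⟨_, ⟨w, by simpa using hw, rfl⟩, c, hstep c w⟩

theorem one_le_maxGrowth (M : Fin r → Matrix (Fin d) (Fin d) ℕ) (n : ℕ) : 1 ≤ maxGrowth M n := by
  unfold maxGrowth
  induction rowSumList M n with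
  | nil => simp
  | cons v l ih => exact ih.trans (le_max_right _ _)

theorem sum_wordProd_le_maxGrowth (M : Fin r → Matrix (Fin d) (Fin d) ℕ) (w : List (Fin r)) :
    ∑ p, ∑ q, wordProd M w p q ≤ maxGrowth M w.length := by
  have hmem := (mem_rowSumList M w.length _).2 ⟨w, rfl, rfl⟩
  unfold maxGrowth
  generalize hv : (fun p => ∑ q, wordProd M w p q) = v at hmem
  change ∑ p, v p ≤ _
  clear hv
  generalize rowSumList M w.length = l at hmem ⊢
  induction l with
  | nil => simp at hmem
  | cons u l ih =>
    rcases List.mem_cons.1 hmem with rfl | h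
    · exact le_max_left _ _
    · exact (ih h).trans (le_max_right _ _)

theorem maxGrowth_eq_or (M : Fin r → Matrix (Fin d) (Fin d) ℕ) (n : ℕ) :
    maxGrowth M n = 1 ∨
      ∃ w : List (Fin r), w.length = n ∧ maxGrowth M n = ∑ p, ∑ q, wordProd M w p q := by
  have key : ∀ l : List (Fin d → ℕ), l.foldr (fun v m => max (∑ i, v i) m) 1 = 1 ∨
      ∃ v ∈ l, l.foldr (fun v m => max (∑ i, v i) m) 1 = ∑ i, v i := by
    intro l
    induction l with
    | nil => simp
    | cons u l ih =>
      rw [List.foldr_cons]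
      rcases le_total (∑ i, u i) (l.foldr (fun v m => max (∑ i, v i) m) 1) with h | h
      · rw [max_eq_right h]
        exact ih.imp_right fun ⟨v, hv, hv'⟩ => ⟨v, List.mem_cons_of_mem _ hv, hv'⟩
      · rw [max_eq_left h]
        exact Or.inr ⟨u, by simp, rfl⟩
  refine (key _).imp_right ?_
  rintro ⟨v, hv, hv'⟩
  obtain ⟨w, hw, rfl⟩ := (mem_rowSumList M n v).1 hv
  exact ⟨w, hw, hv'⟩

theorem primrec_finset_sum {α ι : Type*} [Primcodable α] (s : Finset ι) {f : ι → α → ℕ}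
    (hf : ∀ i, Primrec (f i)) : Primrec fun a => ∑ i ∈ s, f i a := by
  classical
  induction s using Finset.induction_on with
  | empty => simpa using Primrec.const 0
  | insert i s hi ih =>
    simp only [Finset.sum_insert hi]
    exact Primrec.nat_add.comp (hf i) ih

theorem primrec_maxGrowth (M : Fin r → Matrix (Fin d) (Fin d) ℕ) : Primrec (maxGrowth M) := by
  have hstep : Primrec₂ (fun (v : Fin d → ℕ) (c : Fin r) i => ∑ j, M c i j * v j) := by
    refine Primrec.fin_curry.2 (primrec_finset_sum _ fun j => ?_)
    have hM : Primrec (fun x : Fin r × Fin d => M x.1 x.2 j) := Primrec.dom_finite _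
    have happ : Primrec (fun v : Fin d → ℕ => v j) :=
      Primrec.fin_app.comp Primrec.id (Primrec.const j)
    exact Primrec.nat_mul.comp
      (hM.comp (Primrec.pair (Primrec.snd.comp Primrec.fst) Primrec.snd))
      (happ.comp (Primrec.fst.comp Primrec.fst))
  have hlist : Primrec (rowSumList M) := by
    refine (Primrec.nat_rec₁ (f := fun _ l => l.flatMap fun v => (List.finRange r).map
      fun c i => ∑ j, M c i j * v j) [fun _ => 1] ?_).of_eq fun n => ?_
    · exact Primrec.list_flatMap Primrec.snd
        (Primrec.list_map (Primrec.const _) (hstep.comp (Primrec.snd.comp Primrec.fst) Primrec.snd))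
    · induction n with
      | zero => rfl
      | succ n ih => simp only [ih, rowSumList]
  refine (Primrec.list_foldr (h := fun _ (x : (Fin d → ℕ) × ℕ) => max (∑ i, x.1 i) x.2) hlist
    (Primrec.const 1) ?_).of_eq fun n => rfl
  refine Primrec.nat_max.comp (primrec_finset_sum _ fun j => ?_) (Primrec.snd.comp Primrec.snd)
  have happ : Primrec (fun v : Fin d → ℕ => v j) :=
    Primrec.fin_app.comp Primrec.id (Primrec.const j)
  exact happ.comp (Primrec.fst.comp Primrec.snd)

theorem primrec_pow : Primrec₂ (fun a b : ℕ => a ^ b) := by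
  refine (Primrec.nat_rec' (f := fun x : ℕ × ℕ => x.2) (g := fun _ => 1)
    (h := fun x y => x.1 * y.2) Primrec.snd (Primrec.const 1)
    (Primrec.nat_mul.comp (Primrec.fst.comp Primrec.fst) (Primrec.snd.comp Primrec.snd))).of_eq
    fun x => ?_
  obtain ⟨a, b⟩ := x
  induction b with
  | zero => rfl
  | succ b ih =>
    simp only at ih ⊢
    rw [ih, pow_succ, mul_comm]

theorem primrec_log_two : Primrec (Nat.log 2) := by
  have hle : PrimrecRel (fun x y : ℕ => 2 ^ y ≤ x) :=
    Primrec.nat_le.comp (primrec_two_pow.comp Primrec.snd) Primrec.fst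
  refine (Primrec.nat_findGreatest Primrec.id hle).of_eq fun x => ?_
  rcases Nat.eq_zero_or_pos x with rfl | hx
  · simp
  · rw [Nat.findGreatest_eq_iff]
    refine ⟨Nat.log_le_self 2 x, fun _ => Nat.pow_log_le_self 2 hx.ne', fun n hn _ hn' => ?_⟩
    exact absurd hn' (not_le.2 (Nat.lt_pow_of_log_lt (by norm_num) hn))

theorem floor_natLog_div (a s m : ℕ) :
    Nat.log 2 (a ^ s) / m = ⌊(s : ℝ) * (Real.logb 2 a / m)⌋₊ := by
  have h1 : (s : ℝ) * (Real.logb 2 a / m) = Real.logb 2 ((a ^ s : ℕ) : ℝ) / m := by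
    push_cast
    rw [Real.logb_pow]
    ring
  rw [h1, Nat.floor_div_natCast]
  congr 1
  have := Real.natFloor_logb_natCast 2 (a ^ s)
  simpa using this.symm

/-- A real number approximated by `logb 2 (maxGrowth M n) / (n * P)` up to an error
`O(log n / n)` is computable. -/
theorem isComputableReal_of_maxGrowth (M : Fin r → Matrix (Fin d) (Fin d) ℕ) (h : ℝ) {P : ℕ}
    (hP : 0 < P) (K : ℝ) (D : ℕ)
    (hup : ∀ n : ℕ, 0 < n → n * P * h ≤ Real.logb 2 (maxGrowth M n))
    (hlow : ∀ n : ℕ, 0 < n →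
      Real.logb 2 (maxGrowth M n) ≤ K + D * Real.logb 2 (n + 1) + n * P * h) :
    IsComputableReal h := by
  obtain ⟨e, he⟩ : ∃ e : ℕ, 2 * (|K| + 2 * D) ≤ (2 : ℝ) ^ e :=
    (pow_unbounded_of_one_lt _ (by norm_num)).imp fun _ h => h.le
  set N : ℕ → ℕ := fun n => 4 ^ (n + e) with hN
  set k : ℕ → ℕ := fun n => Nat.log 2 (maxGrowth M (N n) ^ (2 ^ n)) / (N n * P) with hk
  have hNprim : Primrec N := primrec_pow.comp (Primrec.const 4)
    (Primrec.nat_add.comp Primrec.id (Primrec.const e))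
  have hkprim : Primrec k := Primrec.nat_div.comp
    (primrec_log_two.comp (primrec_pow.comp ((primrec_maxGrowth M).comp hNprim) primrec_two_pow))
    (Primrec.nat_mul.comp hNprim (Primrec.const P))
  refine ⟨_, computable_odd_dyadic hkprim.to_comp, fun n => ?_⟩
  have hNpos : 0 < N n := by simp [hN]
  set g : ℝ := Real.logb 2 (maxGrowth M (N n)) / ((N n * P : ℕ) : ℝ) with hg
  have hg0 : 0 ≤ g := div_nonneg (Real.logb_nonneg (by norm_num)
    (by exact_mod_cast one_le_maxGrowth M _)) (by positivity)
  have hkg : k n = ⌊(2 : ℝ) ^ n * g⌋₊ := by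
    have := floor_natLog_div (maxGrowth M (N n)) (2 ^ n) (N n * P)
    push_cast at this
    simpa [hk, hg] using this
  have hP1 : (1 : ℝ) ≤ P := by exact_mod_cast hP
  have hNr : (0 : ℝ) < N n := by exact_mod_cast hNpos
  have hNP : (0 : ℝ) < N n * P := by positivity
  have hg1 : h ≤ g := by
    rw [hg, le_div_iff₀ (by push_cast; exact hNP)]
    push_cast
    linarith [hup (N n) hNpos]
  have hpow : (N n : ℝ) = 2 ^ (n + e) * 2 ^ (n + e) := by
    simp only [hN]
    push_cast
    rw [← mul_pow]
    norm_num
  have hlog : Real.logb 2 ((N n : ℝ) + 1) ≤ 2 * 2 ^ (n + e) := by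
    have h1 : (N n : ℝ) + 1 ≤ (2 : ℝ) ^ (2 * (n + e) + 1) := by
      have : (1 : ℝ) ≤ 2 ^ (n + e) := one_le_pow₀ (by norm_num)
      rw [pow_succ, two_mul, pow_add, ← hpow]
      nlinarith [hpow]
    have h2 : Real.logb 2 ((N n : ℝ) + 1) ≤ ((2 * (n + e) + 1 : ℕ) : ℝ) := by
      rw [Real.logb_le_iff_le_rpow (by norm_num) (by positivity), Real.rpow_natCast]
      exact h1
    have h3 : (2 * (n + e) + 1 : ℕ) ≤ 2 * 2 ^ (n + e) := by
      have := Nat.lt_two_pow_self (n := n + e)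
      omega
    exact h2.trans (by exact_mod_cast h3)
  have hg2 : g ≤ h + (2 : ℝ)⁻¹ ^ (n + 1) := by
    rw [hg, div_le_iff₀ (by push_cast; exact hNP)]
    push_cast
    have h1 := hlow (N n) hNpos
    have hD : (0 : ℝ) ≤ D := Nat.cast_nonneg _
    have h2 : K + D * Real.logb 2 ((N n : ℝ) + 1) ≤ (|K| + 2 * D) * 2 ^ (n + e) := by
      have h3 : (1 : ℝ) ≤ 2 ^ (n + e) := one_le_pow₀ (by norm_num)
      nlinarith [le_abs_self K, abs_nonneg K, mul_le_mul_of_nonneg_left hlog hD]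
    have h4 : (|K| + 2 * D) * 2 ^ (n + e) ≤ (2 : ℝ)⁻¹ ^ (n + 1) * (N n * P) := by
      have h5 : (2 : ℝ)⁻¹ ^ (n + 1) * N n = 2⁻¹ * 2 ^ e * 2 ^ (n + e) := by
        rw [hpow, pow_succ, pow_add]
        have : (2 : ℝ)⁻¹ ^ n * 2 ^ n = 1 := by
          rw [← mul_pow]; norm_num
        linear_combination (2⁻¹ * (2 : ℝ) ^ e * (2 ^ n * 2 ^ e)) * this
      have h6 : (|K| + 2 * D) * 2 ^ (n + e) ≤ (2 : ℝ)⁻¹ ^ (n + 1) * N n := by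
        rw [h5]
        exact mul_le_mul_of_nonneg_right (by linarith) (by positivity)
      calc _ ≤ (2 : ℝ)⁻¹ ^ (n + 1) * N n := h6
        _ ≤ (2 : ℝ)⁻¹ ^ (n + 1) * N n * P := le_mul_of_one_le_right (by positivity) hP1
        _ = _ := by ring
    nlinarith
  have hf1 := Nat.floor_le (mul_nonneg (by positivity : (0 : ℝ) ≤ 2 ^ n) hg0)
  have hf2 := Nat.lt_floor_add_one ((2 : ℝ) ^ n * g)
  rw [← hkg] at hf1 hf2
  have hinv : (2 : ℝ)⁻¹ ^ (n + 1) * 2 ^ (n + 1) = 1 := by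
    rw [← mul_pow]; norm_num
  have hq0 : (0 : ℝ) < 2⁻¹ ^ (n + 1) := by positivity
  have hval : ((((2 * k n + 1 : ℕ) : ℚ) / ((2 ^ (n + 1) : ℕ) : ℚ) : ℚ) : ℝ) =
      (2 * k n + 1) * (2 : ℝ)⁻¹ ^ (n + 1) := by
    push_cast
    rw [inv_pow]
    rfl
  have hz : (2 : ℝ) ^ (-(n : ℤ)) = 2 * (2 : ℝ)⁻¹ ^ (n + 1) := by
    rw [zpow_neg, zpow_natCast, pow_succ, inv_pow]
    ring
  rw [hval, hz, abs_le]
  have hgq : g = (2 : ℝ)⁻¹ ^ (n + 1) * (2 * (2 ^ n * g)) := by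
    rw [pow_succ (2 : ℝ) n] at hinv
    linear_combination -g * hinv
  constructor <;> nlinarith

end GrowthComputable

section Phases

open Relation

variable {A : Type*} (E : A → A → Prop)

/-- Successors inside the strongly connected component. -/
def succSet (c : Set A) : Set A := {b | ∃ a ∈ c, E a b ∧ TransGen E b a}

theorem isSCC_of_transGen {a : A} (ha : TransGen E a a) :
    IsSCC E {b | TransGen E a b ∧ TransGen E b a} := by
  refine ⟨⟨a, ha, ha⟩, fun x hx y hy => hx.2.trans hy.1, fun T hT h => ?_⟩
  refine subset_antisymm (fun b hb => ?_) hT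
  exact ⟨h a (hT ⟨ha, ha⟩) b hb, h b hb a (hT ⟨ha, ha⟩)⟩

variable {E}

theorem succSet_level {S : Set A} (hS : IsSCC E S) {p : ℕ} {f : A → ZMod p}
    (hf : ∀ i : ZMod p, ∃ v ∈ S, f v = i)
    (hE : ∀ v ∈ S, ∀ w ∈ S, (E v w ↔ f w = f v + 1)) (i : ZMod p) :
    succSet E {v ∈ S | f v = i} = {v ∈ S | f v = i + 1} := by
  ext b
  constructor
  · rintro ⟨a, ⟨ha, rfl⟩, hab, hba⟩
    have hb : b ∈ S := by
      have hT := hS.2.2 {x | TransGen E a x ∧ TransGen E x a}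
        (fun x hx => ⟨hS.2.1 a ha x hx, hS.2.1 x hx a ha⟩)
        (fun x hx y hy => hx.2.trans hy.1)
      rw [← hT]
      exact ⟨TransGen.single hab, hba⟩
    exact ⟨hb, (hE a ha b hb).1 hab⟩
  · rintro ⟨hb, hbi⟩
    obtain ⟨a, ha, rfl⟩ := hf i
    exact ⟨a, ⟨ha, rfl⟩, (hE a ha b hb).2 hbi, hS.2.1 b hb a ha⟩

theorem succSet_singleton {S : Set A} (hS : IsSCC E S) {p : ℕ} {f : A → ZMod p}
    (hE : ∀ v ∈ S, ∀ w ∈ S, (E v w ↔ f w = f v + 1)) {a : A} (ha : a ∈ S) :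
    succSet E {a} = {v ∈ S | f v = f a + 1} := by
  ext b
  constructor
  · rintro ⟨_, rfl, hab, hba⟩
    have hb : b ∈ S := by
      have hT := hS.2.2 {x | TransGen E b x ∧ TransGen E x b}
        (fun x hx => ⟨hba.trans (hS.2.1 _ ha x hx), (hS.2.1 x hx _ ha).tail hab⟩)
        (fun x hx y hy => hx.2.trans hy.1)
      rw [← hT]
      exact ⟨hba.tail hab, hba.tail hab⟩
    exact ⟨hb, (hE _ ha b hb).1 hab⟩
  · rintro ⟨hb, hbi⟩
    exact ⟨a, rfl, (hE a ha b hb).2 hbi, hS.2.1 b hb a ha⟩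

theorem iterate_succSet_level {S : Set A} (hS : IsSCC E S) {p : ℕ} {f : A → ZMod p}
    (hf : ∀ i : ZMod p, ∃ v ∈ S, f v = i)
    (hE : ∀ v ∈ S, ∀ w ∈ S, (E v w ↔ f w = f v + 1)) (i : ZMod p) (n : ℕ) :
    (succSet E)^[n] {v ∈ S | f v = i} = {v ∈ S | f v = i + n} := by
  induction n with
  | zero => simp
  | succ n ih =>
    rw [Function.iterate_succ_apply', ih, succSet_level hS hf hE]
    push_cast
    rw [add_assoc]

theorem iterate_succSet_singleton {S : Set A} (hS : IsSCC E S) {p : ℕ} {f : A → ZMod p}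
    (hf : ∀ i : ZMod p, ∃ v ∈ S, f v = i)
    (hE : ∀ v ∈ S, ∀ w ∈ S, (E v w ↔ f w = f v + 1)) {a : A} (ha : a ∈ S) {n : ℕ}
    (hn : 0 < n) :
    (succSet E)^[n] {a} = {v ∈ S | f v = f a + n} := by
  obtain ⟨n, rfl⟩ := Nat.exists_eq_succ_of_ne_zero hn.ne'
  rw [Function.iterate_succ_apply, succSet_singleton hS hE ha, iterate_succSet_level hS hf hE]
  push_cast
  rw [add_comm (n : ZMod p) 1, add_assoc]

theorem iterate_succSet_empty (n : ℕ) : (succSet E)^[n] (∅ : Set A) = ∅ :=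
  Function.iterate_fixed (by simp [succSet]) n

/-- Combinatorial data of a graph all of whose strongly connected components are state-split
cycles: phases permuted cyclically, and a rank that is constant along an edge exactly when the
edge stays within a component. -/
theorem exists_phases [Fintype A] (hss : ∀ S : Set A, IsSCC E S → StateSplitType E S) :
    ∃ (r P R : ℕ) (σ : Fin r → Fin r) (mem : Fin r → Set A) (cl : A → Fin r) (rank : A → Fin R),
      0 < P ∧ (∀ c, σ^[P] c = c) ∧ (∀ c, ∀ a ∈ mem c, ∀ b ∈ mem (σ c), E a b) ∧
      ∀ a b, E a b → rank a ≤ rank b ∧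
        (rank a = rank b → a ∈ mem (cl a) ∧ b ∈ mem (cl b) ∧ cl b = σ (cl a)) := by
  classical
  set P := (Fintype.card A).factorial with hPdef
  have hP : 0 < P := Nat.factorial_pos _
  have hdvd : ∀ (S : Set A) (p : ℕ) (f : A → ZMod p), 0 < p →
      (∀ i : ZMod p, ∃ v ∈ S, f v = i) → ((P : ℕ) : ZMod p) = 0 := by
    intro S p f hp hf
    have : NeZero p := ⟨hp.ne'⟩
    have hcard : p ≤ Fintype.card A := by
      have := Fintype.card_le_of_surjective f fun i => (hf i).imp fun v hv => hv.2
      rwa [ZMod.card] at this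
    rw [ZMod.natCast_eq_zero_iff]
    exact Nat.dvd_factorial hp hcard
  let C := {c : Set A // (succSet E)^[P] c = c ∧
    ∀ n, ∀ a ∈ (succSet E)^[n] c, ∀ b ∈ (succSet E)^[n + 1] c, E a b}
  let sig : C → C := fun c => ⟨succSet E c.1, by
    refine ⟨?_, fun n => ?_⟩
    · rw [← Function.iterate_succ_apply, Function.iterate_succ_apply', c.2.1]
    · have := c.2.2 (n + 1)
      simpa only [← Function.iterate_succ_apply] using this⟩
  have hsig : ∀ n (c : C), (sig^[n] c).1 = (succSet E)^[n] c.1 := by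
    intro n c
    induction n with
    | zero => rfl
    | succ n ih => rw [Function.iterate_succ_apply', Function.iterate_succ_apply', ← ih]
  have hempty : ∀ a, ¬ TransGen E a a → (succSet E)^[P] {a} = ∅ := by
    intro a ha
    obtain ⟨n, hn⟩ := Nat.exists_eq_succ_of_ne_zero hP.ne'
    have : succSet E {a} = ∅ := by
      ext b
      simp only [succSet, Set.mem_singleton_iff, exists_eq_left, Set.mem_ofPred_eq,
        Set.mem_empty_iff_false, iff_false]
      exact fun h => ha ((TransGen.single h.1).trans h.2)
    rw [hn, Function.iterate_succ_apply, this, iterate_succSet_empty]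
  let cls : A → C := fun a => ⟨(succSet E)^[P] {a}, by
    by_cases ha : TransGen E a a
    · have hS := isSCC_of_transGen E ha
      obtain ⟨p, hp, f, hf, hE⟩ := hss _ hS
      have hP0 := hdvd _ p f hp hf
      rw [iterate_succSet_singleton hS hf hE ⟨ha, ha⟩ hP]
      refine ⟨by rw [iterate_succSet_level hS hf hE, hP0, add_zero], fun n x hx y hy => ?_⟩
      rw [iterate_succSet_level hS hf hE] at hx hy
      rw [hE x hx.1 y hy.1, hx.2, hy.2]
      push_cast
      ring
    · rw [hempty a ha, iterate_succSet_empty]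
      refine ⟨rfl, fun n x hx => ?_⟩
      rw [iterate_succSet_empty] at hx
      exact absurd hx (Set.notMem_empty x)⟩
  have hfin : Finite C := inferInstance
  obtain ⟨r, ⟨e⟩⟩ := Finite.exists_equiv_fin C
  let rk : A → Fin (Fintype.card A + 1) := fun a =>
    ⟨Set.ncard {b | ReflTransGen E b a}, by
      rw [← Nat.card_eq_fintype_card]
      exact Nat.lt_succ_of_le (Set.ncard_le_card _)⟩
  refine ⟨r, P, Fintype.card A + 1, fun c => e (sig (e.symm c)), fun c => (e.symm c).1,
    fun a => e (cls a), rk, hP, fun c => ?_, fun c a ha b hb => ?_, fun a b hab => ?_⟩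
  · have hconj : ∀ n, (fun c => e (sig (e.symm c)))^[n] c = e (sig^[n] (e.symm c)) := by
      intro n
      induction n with
      | zero => simp
      | succ n ih => rw [Function.iterate_succ_apply', Function.iterate_succ_apply', ih]; simp
    rw [hconj, ← e.eq_symm_apply]
    exact Subtype.ext ((hsig P _).trans (e.symm c).2.1)
  · change b ∈ (e.symm (e (sig (e.symm c)))).1 at hb
    rw [e.symm_apply_apply] at hb
    exact (e.symm c).2.2 0 a ha b hb
  · have hsub : {x | ReflTransGen E x a} ⊆ {x | ReflTransGen E x b} := fun x hx => hx.tail hab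
    refine ⟨Set.ncard_le_ncard hsub (Set.toFinite _), fun heq => ?_⟩
    have hba : ReflTransGen E b a := by
      have hset := Set.eq_of_subset_of_ncard_le hsub (Fin.ext_iff.1 heq).ge (Set.toFinite _)
      exact hset.ge (ReflTransGen.refl : ReflTransGen E b b)
    have haa : TransGen E a a := TransGen.head' hab hba
    have hba' : TransGen E b a := by
      rcases reflTransGen_iff_eq_or_transGen.1 hba with rfl | h
      · exact haa
      · exact h
    have hS := isSCC_of_transGen E haa
    obtain ⟨p, hp, f, hf, hE⟩ := hss _ hS
    have hP0 := hdvd _ p f hp hf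
    have hbS : b ∈ {b | TransGen E a b ∧ TransGen E b a} := ⟨TransGen.single hab, hba'⟩
    have ha1 := iterate_succSet_singleton hS hf hE ⟨haa, haa⟩ hP
    have hb1 := iterate_succSet_singleton hS hf hE hbS hP
    rw [hP0, add_zero] at ha1 hb1
    simp only [e.symm_apply_apply, EmbeddingLike.apply_eq_iff_eq]
    refine ⟨?_, ?_, Subtype.ext ?_⟩
    · change a ∈ (succSet E)^[P] {a}
      rw [ha1]
      exact ⟨⟨haa, haa⟩, rfl⟩
    · change b ∈ (succSet E)^[P] {b}
      rw [hb1]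
      exact ⟨hbS, rfl⟩
    · change (succSet E)^[P] {b} = succSet E ((succSet E)^[P] {a})
      rw [ha1, hb1, succSet_level hS hf hE, (hE a ⟨haa, haa⟩ b hbS).1 hab]

end Phases

section Presentation

variable {A : Type*}

/-- One step of the sliding window of width `K + 1` for the shift of finite type avoiding `F`. -/
def WindowStep (F : Finset (List A)) (K : ℕ) (y y' : Fin (K + 1) → A) : Prop :=
  (∀ w ∈ F, ¬ ∀ (n : ℕ) (h : n < w.length) (h' : n < K + 1), y ⟨n, h'⟩ = w.get ⟨n, h⟩) ∧
    ∀ s : Fin K, y s.succ = y' s.castSucc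

theorem windowStep_deterministic {F : Finset (List A)} {K : ℕ} {y y' y'' : Fin (K + 1) → A}
    (h : WindowStep F K y y') (h' : WindowStep F K y y'')
    (hl : y' (Fin.last K) = y'' (Fin.last K)) : y' = y'' := by
  funext s
  induction s using Fin.lastCases with
  | last => exact hl
  | cast s => rw [← h.2, ← h'.2]

theorem window_eq_last {F : Finset (List A)} {K : ℕ} {y : ℤ → Fin (K + 1) → A}
    (hy : ∀ j, WindowStep F K (y j) (y (j + 1))) (m s : ℕ) (hs : s < K + 1) (hm : s + m = K)
    (j : ℤ) : y j ⟨s, hs⟩ = y (j - m) (Fin.last K) := by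
  induction m generalizing s j with
  | zero =>
    have : (⟨s, hs⟩ : Fin (K + 1)) = Fin.last K := Fin.ext (by simpa using hm)
    simp [this]
  | succ m ih =>
    have h1 := ih (s + 1) (by omega) (by omega) (j - 1)
    have h2 := (hy (j - 1)).2 ⟨s, by omega⟩
    rw [sub_add_cancel] at h2
    have h3 : j - 1 - (m : ℤ) = j - ((m + 1 : ℕ) : ℤ) := by push_cast; ring
    rw [← h3, ← h1]
    exact h2.symm

theorem mem_SFT1_iff_window {F : Finset (List A)} {K : ℕ} (hK : ∀ w ∈ F, w.length ≤ K)
    (x : ℤ → A) : x ∈ SFT1 F ↔ ∃ y : ℤ → Fin (K + 1) → A,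
      (∀ j, WindowStep F K (y j) (y (j + 1))) ∧ ∀ j, y j (Fin.last K) = x j := by
  constructor
  · intro hx
    refine ⟨fun j s => x (j - K + (s : ℕ)), fun j => ⟨fun w hw hocc => ?_, fun s => ?_⟩,
      fun j => ?_⟩
    · refine hx w hw ⟨j - K, fun n h => ?_⟩
      exact hocc n h (by have := hK w hw; omega)
    · simp only [Fin.val_succ, Fin.val_castSucc]
      congr 1
      push_cast
      ring
    · simp
  · rintro ⟨y, hy, hyx⟩ w hw ⟨i, hi⟩
    refine (hy (i + K)).1 w hw fun n h h' => ?_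
    rw [window_eq_last hy (K - n) n h' (by omega), hyx, ← hi n h]
    congr 1
    rw [Nat.cast_sub (by omega)]
    ring

/-- A shift of finite type is presented by a right-resolving labelled graph. -/
theorem exists_presentation [Finite A] {V : Set (ℤ → A)} (hV : IsSFT1 V) :
    ∃ (d : ℕ) (D : Fin d → Fin d → Prop) (lab : Fin d → A),
      (∀ y y' y'', D y y' → D y y'' → lab y' = lab y'' → y' = y'') ∧
      ∀ x, x ∈ V ↔ ∃ y : ℤ → Fin d, (∀ j, D (y j) (y (j + 1))) ∧ ∀ j, lab (y j) = x j := by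
  obtain ⟨F, rfl⟩ := hV
  set K := F.sup List.length
  have hK : ∀ w ∈ F, w.length ≤ K := fun w hw => Finset.le_sup (f := List.length) hw
  obtain ⟨d, ⟨e⟩⟩ := Finite.exists_equiv_fin (Fin (K + 1) → A)
  refine ⟨d, fun y y' => WindowStep F K (e.symm y) (e.symm y'), fun y => e.symm y (Fin.last K),
    fun y y' y'' h h' hl => e.symm.injective (windowStep_deterministic h h' hl), fun x => ?_⟩
  rw [mem_SFT1_iff_window hK]
  constructor
  · rintro ⟨y, hy, hyx⟩
    exact ⟨fun j => e (y j), by simpa using hy, by simpa using hyx⟩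
  · rintro ⟨y, hy, hyx⟩
    exact ⟨fun j => e.symm (y j), hy, hyx⟩

end Presentation

section Walks

variable {J C B : Type*} [Fintype J] [DecidableEq J] (T : C → J → J → Prop) (lab : J → B)

open Classical in
/-- The adjacency matrices of a family of relations. -/
noncomputable def stepMatrix (c : C) : Matrix J J ℕ := fun p q => if T c p q then 1 else 0

open Classical in
/-- The label sequences of the walks from `p` to `q` driven by a word. -/
noncomputable def walkLabels : List C → J → J → Finset (List B)
  | [], p, q => if p = q then {[]} else ∅
  | c :: w, p, q => (Finset.univ.filter (T c p)).biUnion fun p' =>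
      (walkLabels w p' q).image (List.cons (lab p'))

variable {T lab}

theorem card_walkLabels (hT : ∀ c p q q', T c p q → T c p q' → lab q = lab q' → q = q')
    (w : List C) (p q : J) :
    (walkLabels T lab w p q).card = wordProd (stepMatrix T) w p q := by
  classical
  induction w generalizing p with
  | nil =>
    rw [wordProd_nil, walkLabels, Matrix.one_apply]
    split_ifs <;> rfl
  | cons c w ih =>
    rw [walkLabels, wordProd_cons, Matrix.mul_apply, Finset.card_biUnion]
    · rw [Finset.sum_filter]
      refine Finset.sum_congr rfl fun p' _ => ?_
      rw [Finset.card_image_of_injective _ (List.cons_injective), ih, stepMatrix]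
      split_ifs <;> simp
    · intro q₁ h₁ q₂ h₂ hne
      rw [Function.onFun, Finset.disjoint_left]
      intro b hb₁ hb₂
      simp only [Finset.mem_image] at hb₁ hb₂
      obtain ⟨b₁, -, rfl⟩ := hb₁
      obtain ⟨b₂, -, h⟩ := hb₂
      refine hne (hT c p _ _ (by simpa using h₁) (by simpa using h₂) ?_)
      exact (List.cons.inj h).1.symm

theorem mem_walkLabels_iff (w : List C) (p q : J) (b : List B) :
    b ∈ walkLabels T lab w p q ↔ ∃ y : ℕ → J, y 0 = p ∧ y w.length = q ∧
      (∀ (j : ℕ) (h : j < w.length), T w[j] (y j) (y (j + 1))) ∧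
      b = (List.range w.length).map fun j => lab (y (j + 1)) := by
  classical
  induction w generalizing p b with
  | nil =>
    rw [walkLabels]
    constructor
    · intro h
      split_ifs at h with hpq
      · refine ⟨fun _ => p, rfl, hpq, by simp, by simpa using h⟩
      · simp at h
    · rintro ⟨y, rfl, rfl, -, rfl⟩
      simp
  | cons c w ih =>
    rw [walkLabels]
    simp only [Finset.mem_biUnion, Finset.mem_filter, Finset.mem_univ, true_and, Finset.mem_image]
    constructor
    · rintro ⟨p', hp', b', hb', rfl⟩
      obtain ⟨y, h0, hq, hy, rfl⟩ := (ih p' b').1 hb'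
      refine ⟨fun j => if j = 0 then p else y (j - 1), by simp, by simpa using hq, ?_, ?_⟩
      · intro j h
        cases j with
        | zero => simpa [h0] using hp'
        | succ j => simpa using hy j (by simpa using h)
      · simp [List.range_succ_eq_map, h0, Function.comp_def]
    · rintro ⟨y, h0, hq, hy, rfl⟩
      refine ⟨y 1, h0 ▸ hy 0 (by simp), _,
        (ih (y 1) _).2 ⟨fun j => y (j + 1), rfl, hq, fun j h => ?_, rfl⟩, ?_⟩
      · exact hy (j + 1) (by simpa using h)
      · simp [List.range_succ_eq_map, Function.comp_def]

theorem ncard_walk_le (hT : ∀ c p q q', T c p q → T c p q' → lab q = lab q' → q = q')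
    {n : ℕ} (w : Fin n → C) :
    Set.ncard {g : Fin n → B | ∃ y : ℕ → J, ∀ j : Fin n,
      T (w j) (y j) (y (j + 1)) ∧ lab (y (j + 1)) = g j} ≤
      ∑ p, ∑ q, wordProd (stepMatrix T) (List.ofFn w) p q := by
  classical
  set S := {g : Fin n → B | ∃ y : ℕ → J, ∀ j : Fin n,
      T (w j) (y j) (y (j + 1)) ∧ lab (y (j + 1)) = g j}
  set U := Finset.univ.biUnion fun p => Finset.univ.biUnion fun q =>
    walkLabels T lab (List.ofFn w) p q
  have h1 : S.ncard ≤ (U : Set (List B)).ncard := by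
    refine Set.ncard_le_ncard_of_injOn List.ofFn ?_ List.ofFn_injective.injOn (U.finite_toSet)
    rintro g ⟨y, hy⟩
    simp only [U, Finset.coe_biUnion, Set.mem_iUnion, Finset.mem_coe, Finset.mem_univ]
    refine ⟨y 0, trivial, y (List.ofFn w).length, trivial, ?_⟩
    rw [mem_walkLabels_iff]
    refine ⟨y, rfl, rfl, fun j h => ?_, ?_⟩
    · rw [List.getElem_ofFn]
      exact (hy ⟨j, by simpa using h⟩).1
    · refine List.ext_getElem (by simp) fun i hi hi' => ?_
      rw [List.getElem_ofFn, List.getElem_map, List.getElem_range]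
      exact (hy ⟨i, by simpa using hi⟩).2.symm
  refine h1.trans ?_
  rw [Set.ncard_coe_finset]
  refine Finset.card_biUnion_le.trans (Finset.sum_le_sum fun p _ => ?_)
  refine Finset.card_biUnion_le.trans (Finset.sum_le_sum fun q _ => ?_)
  rw [card_walkLabels hT]

end Walks

section PatternEntropy

variable {A : Type*} {X : Set (ℤ × ℤ → A)}

/-- The patterns of `X` on a rectangle. -/
def patSet (X : Set (ℤ × ℤ → A)) (m n : ℕ) : Set (Fin m → Fin n → A) :=
  {p | ∃ x ∈ X, ∀ (i : Fin m) (j : Fin n), x ((i : ℤ), (j : ℤ)) = p i j}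

theorem patCount2_eq_ncard (X : Set (ℤ × ℤ → A)) (m n : ℕ) :
    patCount2 X m n = (patSet X m n).ncard := rfl

variable [Finite A]

theorem one_le_patCount2 (hX : X.Nonempty) (m n : ℕ) : 1 ≤ patCount2 X m n := by
  obtain ⟨x, hx⟩ := hX
  rw [patCount2_eq_ncard, Nat.one_le_iff_ne_zero, Ne, Set.ncard_eq_zero]
  exact Set.Nonempty.ne_empty ⟨fun i j => x (i, j), x, hx, fun _ _ => rfl⟩

theorem patCount2_mul_le
    (hX : ∀ a b : ℤ, ∀ x ∈ X, (fun k : ℤ × ℤ => x (k.1 + a, k.2 + b)) ∈ X) (k m l n : ℕ) :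
    patCount2 X (k * m) (l * n) ≤ patCount2 X m n ^ (k * l) := by
  have key : Nat.card (patSet X (k * m) (l * n)) ≤
      Nat.card (Fin k × Fin l → patSet X m n) := by
    refine Nat.card_le_card_of_injective (fun p ab => ⟨fun i j =>
      p.1 (finProdFinEquiv (ab.1, i)) (finProdFinEquiv (ab.2, j)), ?_⟩) ?_
    · obtain ⟨p, x, hx, hp⟩ := p
      refine ⟨_, hX (m * ab.1 : ℤ) (n * ab.2 : ℤ) x hx, fun i j => ?_⟩
      simp only [← hp]
      simp [finProdFinEquiv]
    · intro p q hpq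
      refine Subtype.ext (funext fun i => funext fun j => ?_)
      have := congrArg Subtype.val (congrFun hpq
        ((finProdFinEquiv.symm i).1, (finProdFinEquiv.symm j).1))
      have := congrFun (congrFun this (finProdFinEquiv.symm i).2) (finProdFinEquiv.symm j).2
      simpa only [Prod.mk.eta, Equiv.apply_symm_apply] using this
  rw [Nat.card_fun, Nat.card_prod, Nat.card_fin, Nat.card_fin, Nat.card_coe_set_eq,
    Nat.card_coe_set_eq] at key
  exact key

theorem logb_patCount2_nonneg (hX : X.Nonempty) (m n : ℕ) :
    0 ≤ Real.logb 2 (patCount2 X m n) :=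
  Real.logb_nonneg (by norm_num) (by exact_mod_cast one_le_patCount2 hX m n)

theorem entropy2_nonneg (hX : X.Nonempty) : 0 ≤ entropy2 X :=
  le_ciInf fun n => div_nonneg (logb_patCount2_nonneg hX _ _) (by positivity)

theorem entropy2_mul_sq_le (hX : X.Nonempty) {N : ℕ} (hN : 0 < N) :
    entropy2 X * (N : ℝ) ^ 2 ≤ Real.logb 2 (patCount2 X N N) := by
  obtain ⟨n, rfl⟩ := Nat.exists_eq_succ_of_ne_zero hN.ne'
  rw [← le_div_iff₀ (by positivity)]
  have : entropy2 X ≤ Real.logb 2 (patCount2 X (n + 1) (n + 1)) / ((n : ℝ) + 1) ^ 2 :=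
    ciInf_le ⟨0, by
      rintro _ ⟨n, rfl⟩
      exact div_nonneg (logb_patCount2_nonneg hX _ _) (by positivity)⟩ n
  simpa using this

theorem entropy2_mul_le (hne : X.Nonempty)
    (hX : ∀ a b : ℤ, ∀ x ∈ X, (fun k : ℤ × ℤ => x (k.1 + a, k.2 + b)) ∈ X) {m n : ℕ}
    (hm : 0 < m) (hn : 0 < n) :
    entropy2 X * m * n ≤ Real.logb 2 (patCount2 X m n) := by
  have h1 := entropy2_mul_sq_le hne (Nat.mul_pos hn hm)
  have h2 : Real.logb 2 (patCount2 X (n * m) (n * m)) ≤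
      (n * m : ℕ) * Real.logb 2 (patCount2 X m n) := by
    rw [← Real.logb_pow]
    refine Real.logb_le_logb_of_le (by norm_num) ?_ ?_
    · exact_mod_cast one_le_patCount2 hne _ _
    · have := patCount2_mul_le hX n m m n
      rw [mul_comm m n] at this
      exact_mod_cast this
  have h3 : (0 : ℝ) < (n * m : ℕ) := by exact_mod_cast Nat.mul_pos hn hm
  refine le_of_mul_le_mul_left ?_ h3
  calc _ = entropy2 X * ((n * m : ℕ) : ℝ) ^ 2 := by push_cast; ring
    _ ≤ _ := h1.trans h2

theorem le_entropy2 (hne : X.Nonempty)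
    (hX : ∀ a b : ℤ, ∀ x ∈ X, (fun k : ℤ × ℤ => x (k.1 + a, k.2 + b)) ∈ X) {c : ℝ} {k : ℕ}
    (hk : 0 < k)
    (hc : ∀ n : ℕ, 0 < n → c * ((k * n : ℕ) : ℝ) ^ 2 ≤
      Real.logb 2 (patCount2 X (k * n) (k * n))) : c ≤ entropy2 X := by
  refine le_ciInf fun n => ?_
  rw [le_div_iff₀ (by positivity)]
  have h2 : Real.logb 2 (patCount2 X (k * (n + 1)) (k * (n + 1))) ≤
      (k * k : ℕ) * Real.logb 2 (patCount2 X (n + 1) (n + 1)) := by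
    rw [← Real.logb_pow]
    refine Real.logb_le_logb_of_le (by norm_num) ?_ ?_
    · exact_mod_cast one_le_patCount2 hne _ _
    · exact_mod_cast patCount2_mul_le hX k (n + 1) k (n + 1)
  have h3 : (0 : ℝ) < (k * k : ℕ) := by exact_mod_cast Nat.mul_pos hk hk
  refine le_of_mul_le_mul_left ?_ h3
  calc _ = c * ((k * (n + 1) : ℕ) : ℝ) ^ 2 := by push_cast; ring
    _ ≤ _ := (hc (n + 1) n.succ_pos).trans h2

end PatternEntropy

section LowerBound

/-- Splitting an integer division at a successor. -/
theorem ediv_emod_succ {L : ℤ} (hL : 0 < L) (t : ℤ) :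
    (t % L + 1 < L ∧ (t + 1) / L = t / L ∧ (t + 1) % L = t % L + 1) ∨
      (t % L + 1 = L ∧ (t + 1) / L = t / L + 1 ∧ (t + 1) % L = 0) := by
  have h1 := Int.emod_lt_of_pos t hL
  have h0 := Int.emod_nonneg t hL.ne'
  have h2 := Int.mul_ediv_add_emod t L
  rcases lt_or_eq_of_le (Int.add_one_le_of_lt h1) with h | h
  · left
    refine ⟨h, ?_⟩
    rw [Int.ediv_emod_unique hL]
    refine ⟨by linarith, by linarith, h⟩
  · right
    refine ⟨h, ?_⟩
    rw [Int.ediv_emod_unique hL]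
    refine ⟨by linarith, le_rfl, hL⟩

theorem ediv_emod_of_lt {L : ℤ} {s j : ℤ} (h0 : 0 ≤ j) (h : j < L) :
    (s * L + j) / L = s ∧ (s * L + j) % L = j := by
  rw [Int.ediv_emod_unique (h0.trans_lt h)]
  exact ⟨by ring, h0, h⟩

/-- Cycles through a common state can be concatenated bi-infinitely. -/
theorem exists_concat_cycles {J C : Type*} {T : C → J → J → Prop} {w : List C} (hw : w ≠ []) {p : J}
    {y : ℤ → ℕ → J} (h0 : ∀ s, y s 0 = p) (hL : ∀ s, y s w.length = p)
    (hy : ∀ s (j : ℕ) (h : j < w.length), T w[j] (y s j) (y s (j + 1))) :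
    ∃ z : ℤ → J,
      (∀ t : ℤ, T (w[(t % w.length).toNat]'(by
        have := List.length_pos_iff.2 hw
        have := Int.emod_lt_of_pos t (Int.natCast_pos.2 this)
        have := Int.emod_nonneg t (b := w.length) (by omega)
        omega)) (z t) (z (t + 1))) ∧
      ∀ (s : ℤ) (j : ℕ), j < w.length → z (s * w.length + j + 1) = y s (j + 1) := by
  have hpos : (0 : ℤ) < w.length := by exact_mod_cast List.length_pos_iff.2 hw
  have hsucc : ∀ t : ℤ, y ((t + 1) / w.length) ((t + 1) % w.length).toNat =
      y (t / w.length) ((t % w.length).toNat + 1) := by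
    intro t
    have hn := Int.emod_nonneg t hpos.ne'
    rcases ediv_emod_succ hpos t with ⟨-, h2, h3⟩ | ⟨h1, h2, h3⟩
    · rw [h2, h3, Int.toNat_add hn (by norm_num)]
      rfl
    · rw [h2, h3, show (t % w.length).toNat + 1 = w.length by omega, hL]
      exact h0 _
  refine ⟨fun t => y (t / w.length) (t % w.length).toNat, fun t => ?_, fun s j hj => ?_⟩
  · simp only [hsucc]
    exact hy _ _ _
  · obtain ⟨h1, h2⟩ := ediv_emod_of_lt (s := s) (Int.natCast_nonneg j) (Int.ofNat_lt.2 hj)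
    simp only [hsucc, h1, h2]
    simp

variable {A : Type*} {E : A → A → Prop} {V : Set (ℤ → A)} {r P d : ℕ} {σ : Fin r → Fin r}
  {mem : Fin r → Set A} {D : Fin d → Fin d → Prop} {lab : Fin d → A}

/-- The joint transitions of `P` consecutive columns, driven by a phase. -/
def blockStep (P : ℕ) (σ : Fin r → Fin r) (mem : Fin r → Set A) (D : Fin d → Fin d → Prop)
    (lab : Fin d → A) (c : Fin r) (q q' : Fin P → Fin d) : Prop :=
  ∀ i : Fin P, D (q i) (q' i) ∧ lab (q' i) ∈ mem (σ^[i] c)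

theorem exists_config_of_cycles (hP : 0 < P) (hσ : ∀ c, σ^[P] c = c)
    (hE : ∀ c, ∀ a ∈ mem c, ∀ b ∈ mem (σ c), E a b)
    (hV : ∀ x, (∃ y : ℤ → Fin d, (∀ j, D (y j) (y (j + 1))) ∧ ∀ j, lab (y j) = x j) → x ∈ V)
    {w : List (Fin r)} (hw : w ≠ []) {p : Fin P → Fin d}
    (b : ℤ → ℤ → List (Fin P → A))
    (hb : ∀ k s, b k s ∈ walkLabels (blockStep P σ mem D lab) (fun q i => lab (q i)) w p p) :
    ∃ x ∈ XHV (vertexShift E) V, ∀ (k s : ℤ), b k s =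
      (List.range w.length).map fun (j : ℕ) (i : Fin P) => x (k * P + i, s * w.length + j) := by
  have hP' : (0 : ℤ) < P := by exact_mod_cast hP
  simp only [mem_walkLabels_iff] at hb
  choose y h0 hL hy hlab using hb
  have hz := fun k => exists_concat_cycles hw (h0 k) (hL k) (hy k)
  choose z hz hzy using hz
  have hlt : ∀ i : ℤ, (i % P).toNat < P := fun i => by
    have := Int.emod_lt_of_pos i hP'
    have := Int.emod_nonneg i hP'.ne'
    omega
  refine ⟨fun u => lab (z (u.1 / P) (u.2 + 1) ⟨(u.1 % P).toNat, hlt _⟩), ⟨fun t i => ?_, fun i => ?_⟩,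
    fun k s => ?_⟩
  · have hm := fun k i => (hz k t i).2
    generalize w[(t % w.length).toNat]'_ = c at hm
    have hi := Int.emod_nonneg i hP'.ne'
    refine hE (σ^[(i % P).toNat] c) _ (hm (i / P) ⟨(i % P).toNat, hlt _⟩) _ ?_
    rw [← Function.iterate_succ_apply' σ]
    have := hm ((i + 1) / P) ⟨((i + 1) % P).toNat, hlt _⟩
    convert this using 2
    rcases ediv_emod_succ hP' i with ⟨-, -, h3⟩ | ⟨h1, -, h3⟩
    · simp only [h3]
      rw [Int.toNat_add hi (by norm_num)]
      rfl
    · simp only [h3]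
      rw [show (i % P).toNat.succ = P by omega, hσ]
      rfl
  · refine hV _ ⟨fun l => z (i / P) (l + 1) ⟨(i % P).toNat, hlt _⟩, fun l => ?_, fun l => rfl⟩
    exact (hz (i / P) (l + 1) _).1
  · rw [hlab]
    refine List.map_congr_left fun j hj => funext fun i => ?_
    obtain ⟨h1, h2⟩ := ediv_emod_of_lt (s := k) (Int.natCast_nonneg i) (Int.ofNat_lt.2 i.2)
    simp only [h1, h2]
    rw [hzy k s j (List.mem_range.1 hj)]
    rfl

theorem pow_wordProd_le_patCount2 [Finite A] (hP : 0 < P) (hσ : ∀ c, σ^[P] c = c)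
    (hE : ∀ c, ∀ a ∈ mem c, ∀ b ∈ mem (σ c), E a b)
    (hD : ∀ y y' y'', D y y' → D y y'' → lab y' = lab y'' → y' = y'')
    (hV : ∀ x, (∃ y : ℤ → Fin d, (∀ j, D (y j) (y (j + 1))) ∧ ∀ j, lab (y j) = x j) → x ∈ V)
    {w : List (Fin r)} (hw : w ≠ []) (p : Fin P → Fin d) {K S : ℕ} (hK : 0 < K) (hS : 0 < S) :
    wordProd (stepMatrix (blockStep P σ mem D lab)) w p p ^ (K * S) ≤
      patCount2 (XHV (vertexShift E) V) (K * P) (S * w.length) := by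
  have hK' : (0 : ℤ) < K := by exact_mod_cast hK
  have hS' : (0 : ℤ) < S := by exact_mod_cast hS
  set W := walkLabels (blockStep P σ mem D lab) (fun q i => lab (q i)) w p p with hW
  have hcard : wordProd (stepMatrix (blockStep P σ mem D lab)) w p p = Nat.card W := by
    rw [← card_walkLabels (lab := fun (q : Fin P → Fin d) i => lab (q i)), ← hW]
    · simp
    · intro c q₀ q q' h h' hqq
      exact funext fun i => hD _ _ _ (h i).1 (h' i).1 (congrFun hqq i)
  have hbK : ∀ k : ℤ, (k % K).toNat < K := fun k => by
    have := Int.emod_lt_of_pos k hK'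
    have := Int.emod_nonneg k hK'.ne'
    omega
  have hbS : ∀ k : ℤ, (k % S).toNat < S := fun k => by
    have := Int.emod_lt_of_pos k hS'
    have := Int.emod_nonneg k hS'.ne'
    omega
  have hex : ∀ b : Fin K × Fin S → W, ∃ x ∈ XHV (vertexShift E) V, ∀ k s, (b (k, s)).1 =
      (List.range w.length).map fun (j : ℕ) (i : Fin P) =>
        x ((k : ℕ) * P + i, (s : ℕ) * w.length + j) := by
    intro b
    obtain ⟨x, hx, h⟩ := exists_config_of_cycles hP hσ hE hV hw
      (fun k s => (b (⟨(k % K).toNat, hbK k⟩, ⟨(s % S).toNat, hbS s⟩)).1) (fun k s => (b _).2)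
    refine ⟨x, hx, fun k s => ?_⟩
    rw [← h]
    congr 3
    · exact Fin.ext (by simp [Int.emod_eq_of_lt (Int.natCast_nonneg _) (Int.ofNat_lt.2 k.2)])
    · exact Fin.ext (by simp [Int.emod_eq_of_lt (Int.natCast_nonneg _) (Int.ofNat_lt.2 s.2)])
  choose x hx hbx using hex
  rw [hcard, patCount2_eq_ncard, ← Nat.card_coe_set_eq]
  have : Nat.card W ^ (K * S) = Nat.card (Fin K × Fin S → W) := by
    rw [Nat.card_fun, Nat.card_prod, Nat.card_fin, Nat.card_fin]
  rw [this]
  refine Nat.card_le_card_of_injective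
    (fun b => ⟨fun i j => x b ((i : ℤ), (j : ℤ)), x b, hx b, fun _ _ => rfl⟩) ?_
  intro b b' hbb
  have hbb := congrArg Subtype.val hbb
  refine funext fun ⟨k, s⟩ => Subtype.ext ?_
  rw [hbx, hbx]
  refine List.map_congr_left fun j hj => funext fun i => ?_
  have := congrFun (congrFun hbb (finProdFinEquiv (k, i)))
    (finProdFinEquiv (s, ⟨j, List.mem_range.1 hj⟩))
  simpa [finProdFinEquiv, mul_comm, add_comm] using this

end LowerBound

section GrowthBounds

theorem wordProd_submatrix {J J' C R : Type*} [Fintype J] [DecidableEq J] [Fintype J']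
    [DecidableEq J'] [Semiring R] (M : C → Matrix J J R) (e : J' ≃ J) (w : List C) :
    wordProd (fun c => (M c).submatrix e e) w = (wordProd M w).submatrix e e := by
  induction w with
  | nil => simp [wordProd_nil]
  | cons c w ih => rw [wordProd_cons, wordProd_cons, ih, Matrix.submatrix_mul_equiv]

theorem logb_maxGrowth_le {r d : ℕ} (M : Fin r → Matrix (Fin d) (Fin d) ℕ) {lam : ℝ}
    (hlam : 1 ≤ lam) (hdiag : ∀ w p, ((wordProd M w p p : ℕ) : ℝ) ≤ lam ^ w.length) :
    ∃ (K : ℝ) (D : ℕ), ∀ n : ℕ, Real.logb 2 (maxGrowth M n) ≤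
      K + D * Real.logb 2 (n + 1) + n * Real.logb 2 lam := by
  obtain ⟨K, hK, D, hKD⟩ := wordProd_poly_growth
    (M := fun c => (M c).map (Nat.cast : ℕ → ℝ)) (fun c p q => by simp) hlam
    (fun w p => by rw [← natCast_wordProd]; exact hdiag w p)
  have h0 : 0 < lam := by linarith
  refine ⟨Real.logb 2 (d * d * K + 1), D, fun n => ?_⟩
  have hn1 : (1 : ℝ) ≤ ((n : ℝ) + 1) ^ D := one_le_pow₀ (by linarith [Nat.cast_nonneg (α := ℝ) n])
  have hl1 : (1 : ℝ) ≤ lam ^ n := one_le_pow₀ hlam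
  have hbound : (maxGrowth M n : ℝ) ≤ (d * d * K + 1) * ((n : ℝ) + 1) ^ D * lam ^ n := by
    have h1 : (1 : ℝ) ≤ ((n : ℝ) + 1) ^ D * lam ^ n := one_le_mul_of_one_le_of_one_le hn1 hl1
    have h2 : 0 ≤ (d : ℝ) * d * K := by positivity
    rcases maxGrowth_eq_or M n with h | ⟨w, hw, h⟩
    · rw [h]
      push_cast
      nlinarith
    · rw [h]
      push_cast
      calc ∑ p, ∑ q, ((wordProd M w p q : ℕ) : ℝ)
          ≤ ∑ _p : Fin d, ∑ _q : Fin d, K * ((n : ℝ) + 1) ^ D * lam ^ n := by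
            refine Finset.sum_le_sum fun p _ => Finset.sum_le_sum fun q _ => ?_
            rw [natCast_wordProd, ← hw]
            exact hKD w p q
        _ = d * d * K * (((n : ℝ) + 1) ^ D * lam ^ n) := by
            simp only [Finset.sum_const, Finset.card_univ, Fintype.card_fin, nsmul_eq_mul]
            ring
        _ ≤ _ := by nlinarith
  calc Real.logb 2 (maxGrowth M n)
      ≤ Real.logb 2 ((d * d * K + 1) * ((n : ℝ) + 1) ^ D * lam ^ n) :=
        Real.logb_le_logb_of_le (by norm_num) (by exact_mod_cast one_le_maxGrowth M n) hbound
    _ = _ := by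
        rw [Real.logb_mul (by positivity) (by positivity),
          Real.logb_mul (by positivity) (by positivity), Real.logb_pow, Real.logb_pow]

variable {A : Type*} {E : A → A → Prop} {V : Set (ℤ → A)} {r P d : ℕ} {σ : Fin r → Fin r}
  {mem : Fin r → Set A} {D : Fin d → Fin d → Prop} {lab : Fin d → A}

theorem wordProd_diag_le [Finite A] (hP : 0 < P) (hσ : ∀ c, σ^[P] c = c)
    (hE : ∀ c, ∀ a ∈ mem c, ∀ b ∈ mem (σ c), E a b)
    (hD : ∀ y y' y'', D y y' → D y y'' → lab y' = lab y'' → y' = y'')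
    (hV : ∀ x, (∃ y : ℤ → Fin d, (∀ j, D (y j) (y (j + 1))) ∧ ∀ j, lab (y j) = x j) → x ∈ V)
    (hne : (XHV (vertexShift E) V).Nonempty)
    (hX : ∀ a b : ℤ, ∀ x ∈ XHV (vertexShift E) V,
      (fun k : ℤ × ℤ => x (k.1 + a, k.2 + b)) ∈ XHV (vertexShift E) V)
    (w : List (Fin r)) (p : Fin P → Fin d) :
    ((wordProd (stepMatrix (blockStep P σ mem D lab)) w p p : ℕ) : ℝ) ≤
      ((2 : ℝ) ^ (P * entropy2 (XHV (vertexShift E) V))) ^ w.length := by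
  rcases eq_or_ne w [] with rfl | hw
  · simp [wordProd_nil]
  have hL : 0 < w.length := List.length_pos_iff.2 hw
  set c := wordProd (stepMatrix (blockStep P σ mem D lab)) w p p with hc
  rcases Nat.eq_zero_or_pos c with h0 | hpos
  · rw [h0]
    push_cast
    positivity
  have hPL : (0 : ℝ) < P * w.length := by
    have h1 : (0 : ℝ) < P := by exact_mod_cast hP
    have h2 : (0 : ℝ) < w.length := by exact_mod_cast hL
    positivity
  have hcpos : (0 : ℝ) < c := by exact_mod_cast hpos
  have key : Real.logb 2 c / (P * w.length) ≤ entropy2 (XHV (vertexShift E) V) := by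
    refine le_entropy2 hne hX (k := P * w.length) (Nat.mul_pos hP hL) fun n hn => ?_
    have h1 := pow_wordProd_le_patCount2 (E := E) hP hσ hE hD hV hw p
      (Nat.mul_pos hL hn) (Nat.mul_pos hP hn)
    rw [← hc, show w.length * n * P = P * w.length * n by ring,
      show P * n * w.length = P * w.length * n by ring] at h1
    calc _ = ((w.length * n * (P * n) : ℕ) : ℝ) * Real.logb 2 c := by
          push_cast
          field_simp
      _ = Real.logb 2 ((c : ℝ) ^ (w.length * n * (P * n))) := (Real.logb_pow _ _ _).symm
      _ ≤ _ := Real.logb_le_logb_of_le (by norm_num) (by positivity) (by exact_mod_cast h1)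
  rw [div_le_iff₀ hPL, Real.logb_le_iff_le_rpow (by norm_num) hcpos] at key
  rw [← Real.rpow_natCast, ← Real.rpow_mul (by norm_num)]
  convert key using 2
  ring

end GrowthBounds

section Signatures

variable {C : Type*} {R N : ℕ}

/-- Sequences of ranked phases whose rank never decreases and whose phase evolves by `σ` while the
rank is constant. -/
def sigSet (σ : C → C) (R N : ℕ) : Set (Fin N → C × Fin R) :=
  {s | ∀ i j : Fin N, (i : ℕ) + 1 = j → (s i).2 ≤ (s j).2 ∧
    ((s i).2 = (s j).2 → (s j).1 = σ (s i).1)}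

theorem sigSet_rank_mono {σ : C → C} {s : Fin N → C × Fin R} (hs : s ∈ sigSet σ R N) {i j : Fin N}
    (hij : i ≤ j) : (s i).2 ≤ (s j).2 := by
  obtain ⟨i, hi⟩ := i
  obtain ⟨j, hj⟩ := j
  replace hij : i ≤ j := hij
  induction j, hij using Nat.le_induction with
  | base => exact le_rfl
  | succ j _ ih => exact (ih (by omega)).trans (hs ⟨j, by omega⟩ ⟨j + 1, hj⟩ rfl).1

/-- The position `i` is the first one of rank `ρ`. -/
def IsFirst (s : Fin N → C × Fin R) (ρ : Fin R) (i : Fin N) : Prop :=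
  (s i).2 = ρ ∧ ∀ j < i, (s j).2 ≠ ρ

theorem IsFirst.unique {s : Fin N → C × Fin R} {ρ : Fin R} {i j : Fin N} (hi : IsFirst s ρ i)
    (hj : IsFirst s ρ j) : i = j := by
  rcases lt_trichotomy i j with h | h | h
  · exact absurd hi.1 (hj.2 i h)
  · exact h
  · exact absurd hj.1 (hi.2 j h)

open Classical in
/-- For each rank, its first position and the phase there. -/
noncomputable def sigCode (s : Fin N → C × Fin R) (ρ : Fin R) : Option (Fin N × C) :=
  if h : ∃ i, IsFirst s ρ i then some (h.choose, (s h.choose).1) else none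

theorem sigCode_of_isFirst {s : Fin N → C × Fin R} {ρ : Fin R} {i : Fin N} (hi : IsFirst s ρ i) :
    sigCode s ρ = some (i, (s i).1) := by
  have h : ∃ i, IsFirst s ρ i := ⟨i, hi⟩
  rw [sigCode, dif_pos h, h.choose_spec.unique hi]

theorem eq_of_sigCode_eq_some {s : Fin N → C × Fin R} {ρ : Fin R} {i : Fin N} {c : C}
    (h : sigCode s ρ = some (i, c)) : s i = (c, ρ) := by
  rw [sigCode] at h
  split_ifs at h with hex
  simp only [Option.some.injEq, Prod.mk.injEq] at h
  rw [← h.1, ← h.2]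
  exact Prod.ext rfl hex.choose_spec.1

theorem sigCode_injOn (σ : C → C) : Set.InjOn sigCode (sigSet σ R N) := by
  intro s hs s' hs' hcode
  have hfirst : ∀ {t t' : Fin N → C × Fin R}, sigCode t = sigCode t' → ∀ i,
      IsFirst t (t i).2 i → t i = t' i := by
    intro t t' htt i hi
    have := sigCode_of_isFirst hi
    rw [htt] at this
    rw [eq_of_sigCode_eq_some this]
  have hrep : ∀ {t : Fin N → C × Fin R}, t ∈ sigSet σ R N → ∀ i k : Fin N, (k : ℕ) + 1 = i →
      ¬ IsFirst t (t i).2 i → (t k).2 = (t i).2 ∧ (t i).1 = σ (t k).1 := by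
    intro t ht i k hk hi
    simp only [IsFirst, true_and, not_forall, not_not] at hi
    obtain ⟨j, hj, hji⟩ := hi
    have h1 : (t k).2 = (t i).2 := le_antisymm (ht k i hk).1
      (hji ▸ sigSet_rank_mono ht (Fin.le_def.2 (by have := Fin.lt_def.1 hj; omega)))
    exact ⟨h1, (ht k i hk).2 h1⟩
  have main : ∀ (n : ℕ) (hn : n < N), s ⟨n, hn⟩ = s' ⟨n, hn⟩ := by
    intro n
    induction n with
    | zero =>
      intro hn
      exact hfirst hcode _ ⟨rfl, fun j hj => absurd (Fin.lt_def.1 hj) (by simp)⟩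
    | succ n ih =>
      intro hn
      by_cases h : IsFirst s (s ⟨n + 1, hn⟩).2 ⟨n + 1, hn⟩
      · exact hfirst hcode _ h
      by_cases h' : IsFirst s' (s' ⟨n + 1, hn⟩).2 ⟨n + 1, hn⟩
      · exact (hfirst hcode.symm _ h').symm
      have h1 := hrep hs _ ⟨n, by omega⟩ rfl h
      have h2 := hrep hs' _ ⟨n, by omega⟩ rfl h'
      rw [ih] at h1
      exact Prod.ext (h1.2.trans h2.2.symm) (h1.1.symm.trans h2.1)
  exact funext fun i => main i i.2

theorem ncard_sigSet_le {r : ℕ} (σ : Fin r → Fin r) (R N : ℕ) :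
    (sigSet σ R N).ncard ≤ (N * r + 1) ^ R := by
  have h := Set.ncard_le_ncard_of_injOn sigCode (t := Set.univ) (fun _ _ => trivial)
    (sigCode_injOn (R := R) (N := N) σ) Set.finite_univ
  rw [Set.ncard_univ] at h
  simpa using h

theorem card_changes_le {σ : C → C} {s : Fin N → C × Fin R} (hs : s ∈ sigSet σ R N) {K : ℕ}
    (u : Fin (K + 1) → Fin N) (hu : Monotone u) :
    (Finset.univ.filter fun k : Fin K => (s (u k.castSucc)).2 ≠ (s (u k.succ)).2).card ≤ R := by
  calc _ ≤ (Finset.univ : Finset (Fin R)).card := by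
        refine Finset.card_le_card_of_injOn (fun k => (s (u k.castSucc)).2) (fun _ _ => by simp) ?_
        have hlt : ∀ k k' : Fin K, (s (u k.castSucc)).2 ≠ (s (u k.succ)).2 → k < k' →
            (s (u k.castSucc)).2 < (s (u k'.castSucc)).2 := by
          intro k k' hk hkk
          refine (lt_of_le_of_ne (sigSet_rank_mono hs (hu ?_)) hk).trans_le
            (sigSet_rank_mono hs (hu ?_))
          · exact k.castSucc_lt_succ.le
          · rw [Fin.le_def]
            simpa using hkk
        intro k hk k' hk' h
        rcases lt_trichotomy k k' with hkk | hkk | hkk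
        · exact absurd h (hlt k k' (by simpa using hk) hkk).ne
        · exact hkk
        · exact absurd h (hlt k' k (by simpa using hk') hkk).ne'
    _ = R := by simp

end Signatures

section UpperBound

variable {A : Type*} {E : A → A → Prop} {V : Set (ℤ → A)} {r P R d : ℕ} {σ : Fin r → Fin r}
  {mem : Fin r → Set A} {cl : A → Fin r} {rank : A → Fin R} {D : Fin d → Fin d → Prop}
  {lab : Fin d → A}

theorem mem_phase_of_rank_eq
    (hrank : ∀ a b, E a b → rank a ≤ rank b ∧
      (rank a = rank b → a ∈ mem (cl a) ∧ b ∈ mem (cl b) ∧ cl b = σ (cl a)))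
    {x : ℤ → A} (hx : x ∈ vertexShift E) {a : ℤ} (h : rank (x a) = rank (x (a + P))) {i : ℕ}
    (hi : i < P) : x (a + i) ∈ mem (σ^[i] (cl (x a))) := by
  have hmono : Monotone fun i => rank (x i) := monotone_int_of_le_succ fun i => (hrank _ _ (hx i)).1
  have hconst : ∀ i : ℕ, i ≤ P → rank (x (a + i)) = rank (x a) := by
    intro i hi
    refine le_antisymm ?_ (hmono (by omega))
    rw [h]
    exact hmono (by omega)
  have hstep : ∀ i : ℕ, i < P → x (a + i) ∈ mem (cl (x (a + i))) ∧
      cl (x (a + (i + 1 : ℕ))) = σ (cl (x (a + i))) := by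
    intro i hi
    have hE := hx (a + i)
    rw [show a + (i : ℤ) + 1 = a + (i + 1 : ℕ) by push_cast; ring] at hE
    have := (hrank _ _ hE).2 (by rw [hconst i hi.le, hconst (i + 1) hi])
    exact ⟨this.1, this.2.2⟩
  have hcl : ∀ i : ℕ, i ≤ P → cl (x (a + i)) = σ^[i] (cl (x a)) := by
    intro i
    induction i with
    | zero => simp
    | succ i ih =>
      intro hi
      rw [(hstep i hi).2, ih (by omega), Function.iterate_succ_apply']
  rw [← hcl i hi.le]
  exact (hstep i hi).1

/-- The ranked phases of a row on an initial interval. -/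
def signature (cl : A → Fin r) (rank : A → Fin R) (N : ℕ) (x : ℤ → A) : Fin N → Fin r × Fin R :=
  fun i => (cl (x i), rank (x i))

theorem signature_mem_sigSet
    (hrank : ∀ a b, E a b → rank a ≤ rank b ∧
      (rank a = rank b → a ∈ mem (cl a) ∧ b ∈ mem (cl b) ∧ cl b = σ (cl a)))
    {x : ℤ → A} (hx : x ∈ vertexShift E) (N : ℕ) : signature cl rank N x ∈ sigSet σ R N := by
  intro i j hij
  have hE := hx i
  rw [show ((i : ℕ) : ℤ) + 1 = (j : ℕ) by exact_mod_cast hij] at hE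
  exact ⟨(hrank _ _ hE).1, fun h => ((hrank _ _ hE).2 h).2.2⟩

/-- The `k`-th blocks of `P` columns among configurations with prescribed row signatures. -/
def blockSet (X : Set (ℤ × ℤ → A)) (cl : A → Fin r) (rank : A → Fin R) (P : ℕ) {N n : ℕ}
    (τ : Fin n → Fin N → Fin r × Fin R) (k : ℕ) : Set (Fin n → Fin P → A) :=
  {g | ∃ x ∈ X, (∀ j : Fin n, signature cl rank N (fun i => x (i, j)) = τ j) ∧
    ∀ (j : Fin n) (i : Fin P), x (k * P + i, j) = g j i}

theorem patCount2_le_sum [Finite A]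
    (hrank : ∀ a b, E a b → rank a ≤ rank b ∧
      (rank a = rank b → a ∈ mem (cl a) ∧ b ∈ mem (cl b) ∧ cl b = σ (cl a)))
    (K n N : ℕ) {B : ℕ}
    (hB : ∀ τ : Fin n → Fin N → Fin r × Fin R, (∀ j, τ j ∈ sigSet σ R N) →
      ∏ k : Fin K, (blockSet (XHV (vertexShift E) V) cl rank P τ k).ncard ≤ B) :
    patCount2 (XHV (vertexShift E) V) (K * P) n ≤ (sigSet σ R N).ncard ^ n * B := by
  classical
  set X := XHV (vertexShift E) V
  have hex : ∀ p : patSet X (K * P) n, ∃ x ∈ X, ∀ (i : Fin (K * P)) (j : Fin n),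
    x ((i : ℤ), (j : ℤ)) = p.1 i j := fun p => p.2
  choose x hx hxp using hex
  have : Fintype (sigSet σ R N) := Fintype.ofFinite _
  have key : Nat.card (patSet X (K * P) n) ≤ Nat.card (Σ τ : Fin n → sigSet σ R N,
      ∀ k : Fin K, blockSet X cl rank P (fun j => (τ j).1) k) := by
    refine Nat.card_le_card_of_injective (fun p => ⟨fun j => ⟨signature cl rank N
      (fun i => x p (i, j)), signature_mem_sigSet hrank ((hx p).1 j) N⟩,
      fun k => ⟨fun j i => x p ((k : ℕ) * P + i, j), x p, hx p, fun j => rfl, fun j i => rfl⟩⟩) ?_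
    intro p q hpq
    have h2 : ∀ (k : Fin K) (j : Fin n) (i : Fin P),
        x p ((k : ℕ) * P + i, j) = x q ((k : ℕ) * P + i, j) := by
      intro k j i
      have := congrArg (fun t : (Σ τ : Fin n → sigSet σ R N,
        ∀ k : Fin K, blockSet X cl rank P (fun j => (τ j).1) k) => (t.2 k).1 j i) hpq
      exact this
    refine Subtype.ext (funext fun i => funext fun j => ?_)
    rw [← hxp, ← hxp]
    have := h2 (finProdFinEquiv.symm i).1 j (finProdFinEquiv.symm i).2
    have hi : (((finProdFinEquiv.symm i).1 : ℕ) : ℤ) * P + ((finProdFinEquiv.symm i).2 : ℕ) =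
        (i : ℕ) := by
      conv_rhs => rw [← finProdFinEquiv.apply_symm_apply i]
      rw [finProdFinEquiv_apply_val]
      push_cast
      ring
    rwa [hi] at this
  rw [patCount2_eq_ncard, ← Nat.card_coe_set_eq]
  refine key.trans ?_
  rw [Nat.card_sigma]
  calc _ ≤ ∑ _τ : Fin n → sigSet σ R N, B := by
        refine Finset.sum_le_sum fun τ _ => ?_
        rw [Nat.card_pi]
        simp only [Nat.card_coe_set_eq]
        exact hB _ fun j => (τ j).2
    _ = _ := by
        rw [Finset.sum_const, Finset.card_univ, smul_eq_mul, ← Nat.card_eq_fintype_card,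
          Nat.card_fun, Nat.card_fin, Nat.card_coe_set_eq]

theorem ncard_blockSet_le_of_rank_eq [Finite A]
    (hrank : ∀ a b, E a b → rank a ≤ rank b ∧
      (rank a = rank b → a ∈ mem (cl a) ∧ b ∈ mem (cl b) ∧ cl b = σ (cl a)))
    (hD : ∀ y y' y'', D y y' → D y y'' → lab y' = lab y'' → y' = y'')
    (hV : ∀ x, x ∈ V → ∃ y : ℤ → Fin d, (∀ j, D (y j) (y (j + 1))) ∧ ∀ j, lab (y j) = x j)
    {K n k : ℕ} (hk : k < K) (u : ℕ → Fin (K * P + 1)) (hu : ∀ k ≤ K, (u k : ℕ) = k * P)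
    (τ : Fin n → Fin (K * P + 1) → Fin r × Fin R)
    (hτ : ∀ j, (τ j (u k)).2 = (τ j (u (k + 1))).2) :
    (blockSet (XHV (vertexShift E) V) cl rank P τ k).ncard ≤
      ∑ p, ∑ q, wordProd (stepMatrix (blockStep P σ mem D lab))
        (List.ofFn fun j => (τ j (u k)).1) p q := by
  refine le_trans (Set.ncard_le_ncard ?_ (Set.toFinite _))
    (ncard_walk_le (lab := fun (q : Fin P → Fin d) i => lab (q i)) ?_ _)
  · rintro g ⟨x, hx, hxτ, hxg⟩
    have hcol := fun i : Fin P => hV _ (hx.2 ((k : ℤ) * P + (i : ℕ)))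
    choose y hy hylab using hcol
    refine ⟨fun t i => y i ((t : ℤ) - 1), fun j => ⟨fun i => ?_, funext fun i => ?_⟩⟩
    · have h1 := hy i ((j : ℕ) - 1)
      rw [sub_add_cancel] at h1
      simp only [Nat.cast_add, Nat.cast_one, add_sub_cancel_right]
      refine ⟨h1, ?_⟩
      rw [hylab]
      have ht : ∀ k' ≤ K, τ j (u k') = (cl (x (k' * P, j)), rank (x (k' * P, j))) := by
        intro k' hk'
        rw [← hxτ, signature]
        simp only [hu k' hk']
        push_cast
        rfl
      have h2 := hτ j
      rw [ht k hk.le, ht (k + 1) hk] at h2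
      rw [ht k hk.le]
      have := mem_phase_of_rank_eq (P := P) hrank (hx.1 j) (a := k * P) (by
        rw [show (k : ℤ) * P + P = (k + 1 : ℕ) * P by push_cast; ring]
        exact h2) i.2
      exact this
    · simp only [Nat.cast_add, Nat.cast_one, add_sub_cancel_right]
      rw [hylab, ← hxg]
  · intro c q₀ q q' h h' hqq
    exact funext fun i => hD _ _ _ (h i).1 (h' i).1 (congrFun hqq i)

theorem patCount2_le_of_walk_count [Finite A] [Nonempty A]
    (hrank : ∀ a b, E a b → rank a ≤ rank b ∧
      (rank a = rank b → a ∈ mem (cl a) ∧ b ∈ mem (cl b) ∧ cl b = σ (cl a)))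
    (hD : ∀ y y' y'', D y y' → D y y'' → lab y' = lab y'' → y' = y'')
    (hV : ∀ x, x ∈ V → ∃ y : ℤ → Fin d, (∀ j, D (y j) (y (j + 1))) ∧ ∀ j, lab (y j) = x j)
    {n G : ℕ} (hG : 1 ≤ G)
    (hwG : ∀ w : List (Fin r), w.length = n →
      ∑ p, ∑ q, wordProd (stepMatrix (blockStep P σ mem D lab)) w p q ≤ G) (K : ℕ) :
    patCount2 (XHV (vertexShift E) V) (K * P) n ≤
      (((K * P + 1) * r + 1) ^ R) ^ n *
        (Nat.card (Fin n → Fin P → A) ^ (n * R) * G ^ K) := by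
  classical
  set β := Nat.card (Fin n → Fin P → A)
  have hβ : 1 ≤ β := Nat.card_pos
  refine (patCount2_le_sum (P := P) hrank K n (K * P + 1) (B := β ^ (n * R) * G ^ K) ?_).trans
    (Nat.mul_le_mul_right _ (Nat.pow_le_pow_left (ncard_sigSet_le σ R _) n))
  intro τ hτ
  set u : ℕ → Fin (K * P + 1) := fun k => ⟨min (k * P) (K * P), by omega⟩ with hu
  have hu' : ∀ k ≤ K, (u k : ℕ) = k * P := fun k hk => min_eq_left (Nat.mul_le_mul_right P hk)
  have humono : Monotone u := fun a b hab =>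
    Fin.le_def.2 (min_le_min_right _ (Nat.mul_le_mul_right P hab))
  set bad : Finset (Fin K) := Finset.univ.filter fun k =>
    ∃ j, (τ j (u k)).2 ≠ (τ j (u (k + 1))).2 with hbad
  have hbadcard : bad.card ≤ n * R := by
    have hsub : bad ⊆ Finset.univ.biUnion fun j => Finset.univ.filter fun k : Fin K =>
        (τ j (u k.castSucc)).2 ≠ (τ j (u k.succ)).2 := by
      intro k hk
      simpa [hbad] using hk
    refine (Finset.card_le_card hsub).trans (Finset.card_biUnion_le.trans ?_)
    calc _ ≤ ∑ _j : Fin n, R := Finset.sum_le_sum fun j _ =>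
          card_changes_le (hτ j) (fun k : Fin (K + 1) => u k) fun a b hab => humono hab
      _ = n * R := by simp
  calc ∏ k : Fin K, (blockSet (XHV (vertexShift E) V) cl rank P τ k).ncard
      ≤ ∏ k : Fin K, (if k ∈ bad then β else 1) * G := by
        refine Finset.prod_le_prod' fun k _ => ?_
        split_ifs with hk
        · refine le_trans ?_ (Nat.le_mul_of_pos_right β hG)
          refine le_of_le_of_eq ?_ (Set.ncard_univ _)
          exact Set.ncard_le_ncard (Set.subset_univ _) (Set.toFinite _)
        · rw [one_mul]
          refine (ncard_blockSet_le_of_rank_eq hrank hD hV k.2 u hu' τ ?_).trans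
            (hwG _ (by simp))
          simpa [hbad] using hk
    _ = β ^ bad.card * G ^ K := by
        rw [Finset.prod_mul_distrib, Finset.prod_ite_mem]
        simp
    _ ≤ _ := Nat.mul_le_mul_right _ (Nat.pow_le_pow_right hβ hbadcard)

end UpperBound

section Shift

variable {A : Type*}

theorem shift_mem_of_isSFT1 {V : Set (ℤ → A)} (hV : IsSFT1 V) (b : ℤ) {x : ℤ → A} (hx : x ∈ V) :
    (fun l => x (l + b)) ∈ V := by
  obtain ⟨F, rfl⟩ := hV
  rintro w hw ⟨i, hi⟩
  refine hx w hw ⟨i + b, fun n h => ?_⟩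
  rw [← hi n h]
  congr 1
  ring

theorem shift_mem_XHV {E : A → A → Prop} {V : Set (ℤ → A)} (hV : IsSFT1 V) (a b : ℤ)
    (x : ℤ × ℤ → A) (hx : x ∈ XHV (vertexShift E) V) :
    (fun k : ℤ × ℤ => x (k.1 + a, k.2 + b)) ∈ XHV (vertexShift E) V := by
  refine ⟨fun j i => ?_, fun i => shift_mem_of_isSFT1 hV b (hx.2 (i + a))⟩
  have := hx.1 (j + b) (i + a)
  rwa [add_right_comm] at this

end Shift

section Limit

/-- A linear bound that holds up to a logarithmic error holds exactly. -/
theorem le_of_forall_mul_le_log {a g c e : ℝ} {f : ℕ} (hf : 0 < f)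
    (h : ∀ K : ℕ, 0 < K → K * a ≤ c * Real.logb 2 (K * f) + e + K * g) : a ≤ g := by
  have hl : Tendsto (fun K : ℕ => Real.log K / K) atTop (nhds 0) := by
    have := (Real.tendsto_pow_log_div_mul_add_atTop 1 0 1 one_ne_zero).comp
      tendsto_natCast_atTop_atTop
    simpa [Function.comp_def] using this
  have hi : Tendsto (fun K : ℕ => (1 : ℝ) / K) atTop (nhds 0) := tendsto_one_div_atTop_nhds_zero_nat
  have ht : Tendsto (fun K : ℕ => c / Real.log 2 * (Real.log K / K) +
      (c * Real.logb 2 f + e) * (1 / K) + g) atTop (nhds (c / Real.log 2 * 0 +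
      (c * Real.logb 2 f + e) * 0 + g)) :=
    ((hl.const_mul _).add (hi.const_mul _)).add_const g
  rw [mul_zero, mul_zero, zero_add, zero_add] at ht
  refine ge_of_tendsto ht (eventually_atTop.2 ⟨1, fun K hK => ?_⟩)
  have hK' : (0 : ℝ) < K := by exact_mod_cast hK
  have hf' : (f : ℝ) ≠ 0 := by exact_mod_cast hf.ne'
  have h1 := h K hK
  rw [Real.logb_mul hK'.ne' hf'] at h1
  refine le_of_mul_le_mul_left (h1.trans_eq ?_) hK'
  rw [Real.logb, Real.logb]
  field_simp
  ring

end Limit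

theorem entropy2_mul_le_logb_of_walk_count {A : Type*} [Finite A] {E : A → A → Prop}
    {V : Set (ℤ → A)} {r P R d : ℕ} {σ : Fin r → Fin r} {mem : Fin r → Set A} {cl : A → Fin r}
    {rank : A → Fin R} {D : Fin d → Fin d → Prop} {lab : Fin d → A} (hP : 0 < P)
    (hrank : ∀ a b, E a b → rank a ≤ rank b ∧
      (rank a = rank b → a ∈ mem (cl a) ∧ b ∈ mem (cl b) ∧ cl b = σ (cl a)))
    (hD : ∀ y y' y'', D y y' → D y y'' → lab y' = lab y'' → y' = y'')
    (hV : ∀ x, x ∈ V → ∃ y : ℤ → Fin d, (∀ j, D (y j) (y (j + 1))) ∧ ∀ j, lab (y j) = x j)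
    (hne : (XHV (vertexShift E) V).Nonempty) (hVS : IsSFT1 V) {n G : ℕ} (hn : 0 < n) (hG : 1 ≤ G)
    (hwG : ∀ w : List (Fin r), w.length = n →
      ∑ p, ∑ q, wordProd (stepMatrix (blockStep P σ mem D lab)) w p q ≤ G) :
    n * P * entropy2 (XHV (vertexShift E) V) ≤ Real.logb 2 G := by
  have : Nonempty A := hne.elim fun x _ => ⟨x 0⟩
  set h := entropy2 (XHV (vertexShift E) V) with hh
  set β := Nat.card (Fin n → Fin P → A)
  have hβ : (0 : ℝ) < β := by exact_mod_cast Nat.card_pos (α := Fin n → Fin P → A)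
  have hG' : (0 : ℝ) < G := by exact_mod_cast hG
  refine le_of_forall_mul_le_log (c := n * R) (e := n * R * Real.logb 2 β)
    (f := (P + 1) * r + 1) (by positivity) fun K hK => ?_
  have h1 := entropy2_mul_le hne (shift_mem_XHV hVS) (Nat.mul_pos hK hP) hn
  have h2 := patCount2_le_of_walk_count (R := R) hrank hD hV hG hwG K
  have h3 : (K * P + 1) * r + 1 ≤ K * ((P + 1) * r + 1) := by
    have : r + 1 ≤ K * (r + 1) := Nat.le_mul_of_pos_left _ hK
    nlinarith
  have h4 : patCount2 (XHV (vertexShift E) V) (K * P) n ≤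
      (K * ((P + 1) * r + 1)) ^ (n * R) * (β ^ (n * R) * G ^ K) := by
    refine h2.trans (Nat.mul_le_mul_right _ ?_)
    rw [← pow_mul, mul_comm R n]
    exact Nat.pow_le_pow_left h3 _
  have hK' : (0 : ℝ) < K := by exact_mod_cast hK
  calc (K : ℝ) * (n * P * h) = h * (K * P : ℕ) * n := by push_cast; ring
    _ ≤ Real.logb 2 (patCount2 (XHV (vertexShift E) V) (K * P) n) := h1
    _ ≤ Real.logb 2 (((K : ℝ) * ((P + 1) * r + 1 : ℕ)) ^ (n * R) *
        ((β : ℝ) ^ (n * R) * (G : ℝ) ^ K)) :=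
      Real.logb_le_logb_of_le (by norm_num)
        (by exact_mod_cast one_le_patCount2 hne (K * P) n) (by exact_mod_cast h4)
    _ = _ := by
      rw [Real.logb_mul (by positivity) (by positivity),
        Real.logb_mul (by positivity) (by positivity), Real.logb_pow, Real.logb_pow, Real.logb_pow]
      push_cast
      ring

/-- if every SCC of the Rauzy graph of `H` is a state-split cycle, then
`h(X_{H,V})` is computable for every vertical SFT `V` with `X_{H,V}` nonempty. -/
theorem stmt15 {A : Type*} [Fintype A] (E : A → A → Prop)
    (hout : ∀ a, ∃ b, E a b) (hin : ∀ a, ∃ b, E b a)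
    (hss : ∀ S : Set A, IsSCC E S → StateSplitType E S)
    (V : Set (ℤ → A)) (hV : IsSFT1 V)
    (hne : (XHV (vertexShift E) V).Nonempty) :
    IsComputableReal (entropy2 (XHV (vertexShift E) V)) := by
  obtain ⟨r, P, R, σ, mem, cl, rank, hP, hσ, hE, hrank⟩ := exists_phases hss
  obtain ⟨d, D, lab, hD, hVD⟩ := exists_presentation hV
  set h := entropy2 (XHV (vertexShift E) V) with hh
  have h0 : 0 ≤ h := entropy2_nonneg hne
  set N := stepMatrix (blockStep P σ mem D lab)
  obtain ⟨s, ⟨f⟩⟩ := Finite.exists_equiv_fin (Fin P → Fin d)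
  set e := f.symm
  set M : Fin r → Matrix (Fin s) (Fin s) ℕ := fun c => (N c).submatrix e e with hM
  have hwp : ∀ w p q, wordProd M w p q = wordProd N w (e p) (e q) := fun w p q => by
    rw [hM, wordProd_submatrix]
    rfl
  obtain ⟨K, D', hKD⟩ := logb_maxGrowth_le M (lam := (2 : ℝ) ^ (P * h))
    (Real.one_le_rpow (by norm_num) (by positivity)) fun w p => by
      rw [hwp]
      exact wordProd_diag_le hP hσ hE hD (fun x hx => (hVD x).2 hx) hne (shift_mem_XHV hV) w (e p)
  refine isComputableReal_of_maxGrowth M h hP K D' (fun n hn => ?_) fun n _ => ?_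
  · refine entropy2_mul_le_logb_of_walk_count hP hrank hD (fun x hx => (hVD x).1 hx) hne hV hn
      (one_le_maxGrowth M n) fun w hw => ?_
    rw [← hw]
    refine le_of_eq_of_le ?_ (sum_wordProd_le_maxGrowth M w)
    simp only [hwp]
    rw [← e.sum_comp]
    exact Finset.sum_congr rfl fun p _ => (e.sum_comp fun q => wordProd N w (e p) q).symm
  · have := hKD n
    rw [Real.logb_rpow (by norm_num) (by norm_num), ← mul_assoc] at this
    exact this
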